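/- arXiv:2605.04168 — 7 statements merged into one kernel-verified Lean document; each statement's English description precedes it below -/
import Mathlib

section
/- Let d ≥ 1, s, s₂ ∈ (0,1), q > d/(1-s), q₂ > 1/(1-s₂), T > 0, and let K ⊂ ℝ^d be compact with positive Lebesgue measure. There exists a constant C = C(d, s, s₂, q, q₂, T, K) such that for every twice continuously differentiable σ : ℝ × ℝ^d → ℝ vanishing outside [0,T] × K, and for all r, u ∈ [0,T] and x, z ∈ K, one has |σ(r,x) - σ(u,z)| ≤ C ( |x - z|^s [ ‖∂_t ∇_z σ‖_{(q₂,q)} + ‖∇_z σ‖_{(q₂,q)} ] + |r - u|^{s₂} [ ‖∂_t ∇_z σ‖_{(q₂,q)} + ‖∂_t σ‖_{(q₂,q)} ] ). -/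
open MeasureTheory
open scoped ENNReal

/-- The mixed Lebesgue norm `‖g‖_{(ρ,q)} = (∫_0^T (∫_K |g(t,x)|^q dx)^{ρ/q} dt)^{1/ρ}`. -/
noncomputable def mnorm (d : ℕ) (T ρ q : ℝ) (K : Set (EuclideanSpace ℝ (Fin d)))
    (g : ℝ → EuclideanSpace ℝ (Fin d) → ℝ) : ℝ :=
  (∫ t in Set.Icc (0:ℝ) T, (∫ x in K, |g t x| ^ q) ^ (ρ / q)) ^ (1 / ρ)

section Morrey

theorem enorm_sub_le_lintegral_fderiv {E : Type*} [NormedAddCommGroup E] [NormedSpace ℝ E]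
    {f : E → ℝ} (hf : ContDiff ℝ 1 f) (x y : E) :
    ‖f x - f y‖ₑ ≤
      ∫⁻ t in Set.Ioc (0:ℝ) 1, ‖y - x‖ₑ * ‖fderiv ℝ f (x + t • (y - x))‖ₑ := by
  have hd : ∀ t : ℝ, HasDerivAt (fun t : ℝ => f (x + t • (y - x)))
      (fderiv ℝ f (x + t • (y - x)) (y - x)) t := fun t => by
    have h1 : HasDerivAt (fun t : ℝ => x + t • (y - x)) (y - x) t := by
      simpa using ((hasDerivAt_id t).smul_const (y - x)).const_add x
    exact ((hf.differentiable one_ne_zero) _).hasFDerivAt.comp_hasDerivAt t h1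
  have hc : Continuous fun t : ℝ => fderiv ℝ f (x + t • (y - x)) (y - x) := by
    have := hf.continuous_fderiv one_ne_zero
    fun_prop
  have h := intervalIntegral.integral_eq_sub_of_hasDerivAt (a := 0) (b := 1)
    (fun t _ => hd t) (hc.intervalIntegrable 0 1)
  rw [intervalIntegral.integral_of_le zero_le_one] at h
  have h2 : ‖f x - f y‖ₑ = ‖∫ t in Set.Ioc (0:ℝ) 1, fderiv ℝ f (x + t • (y - x)) (y - x)‖ₑ := by
    rw [h, ← enorm_neg]
    simp
  rw [h2]
  refine (enorm_integral_le_lintegral_enorm _).trans (lintegral_mono fun t => ?_)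
  rw [mul_comm]
  exact ContinuousLinearMap.le_opENorm _ _

variable {E : Type*} [NormedAddCommGroup E] [NormedSpace ℝ E] [MeasurableSpace E] [BorelSpace E]
  [FiniteDimensional ℝ E] (μ : Measure E) [μ.IsAddHaarMeasure]

theorem lintegral_comp_add_smul_sub {h : E → ℝ≥0∞} (hh : Measurable h) (x : E) {t : ℝ}
    (ht : 0 < t) :
    ∫⁻ y, h (x + t • (y - x)) ∂μ =
      ENNReal.ofReal ((t ^ Module.finrank ℝ E)⁻¹) * ∫⁻ y, h y ∂μ := by
  rw [lintegral_sub_right_eq_self (fun v => h (x + t • v)) x]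
  have h1 := lintegral_map (μ := μ) (f := fun v => h (x + v)) (g := fun v => t • v)
    (by fun_prop) (by fun_prop)
  rw [← h1, Measure.map_addHaar_smul μ ht.ne', lintegral_smul_measure,
    lintegral_add_left_eq_self, abs_of_pos (by positivity), smul_eq_mul]

theorem setLIntegral_enorm_comp_add_smul_sub_le {F : Type*} [NormedAddCommGroup F]
    {G : E → F} (hG : Continuous G) (S : Set E) (x : E) {t q : ℝ} (ht : 0 < t) (hq : 1 ≤ q) :
    ∫⁻ y in S, ‖G (x + t • (y - x))‖ₑ ∂μ ≤
      ENNReal.ofReal (t ^ (-(Module.finrank ℝ E / q))) *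
        (eLpNorm G (ENNReal.ofReal q) μ * μ S ^ (1 - 1 / q)) := by
  have := FiniteDimensional.proper_real E
  have hq0 : 0 < q := by linarith
  have hp0 : ENNReal.ofReal q ≠ 0 := by simpa using hq0
  have hGc : Continuous fun y => G (x + t • (y - x)) := by fun_prop
  have h1 := eLpNorm_le_eLpNorm_mul_rpow_measure_univ (μ := μ.restrict S)
    (f := fun y => G (x + t • (y - x))) (p := 1) (q := ENNReal.ofReal q)
    (by simpa using ENNReal.ofReal_le_ofReal hq)
    hGc.aestronglyMeasurable
  rw [eLpNorm_one_eq_lintegral_enorm] at h1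
  refine h1.trans ?_
  rw [← mul_assoc]
  simp only [Measure.restrict_apply_univ, ENNReal.toReal_one, ENNReal.toReal_ofReal hq0.le,
    div_one]
  gcongr
  refine (eLpNorm_mono_measure _ Measure.restrict_le_self).trans (le_of_eq ?_)
  rw [eLpNorm_eq_lintegral_rpow_enorm_toReal hp0 ENNReal.ofReal_ne_top,
    eLpNorm_eq_lintegral_rpow_enorm_toReal hp0 ENNReal.ofReal_ne_top,
    ENNReal.toReal_ofReal hq0.le,
    lintegral_comp_add_smul_sub μ (h := fun y => ‖G y‖ₑ ^ q)
      ((hG.enorm.measurable).pow_const _) x ht,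
    ENNReal.mul_rpow_of_nonneg _ _ (by positivity), ENNReal.ofReal_rpow_of_nonneg (by positivity)
      (by positivity)]
  congr 2
  rw [← Real.rpow_natCast, ← Real.rpow_neg ht.le, ← Real.rpow_mul ht.le]
  congr 1
  ring

theorem lintegral_ofReal_rpow_neg {a : ℝ} (ha : a < 1) :
    ∫⁻ t in Set.Ioc (0:ℝ) 1, ENNReal.ofReal (t ^ (-a)) = ENNReal.ofReal (1 / (1 - a)) := by
  rw [← ofReal_integral_eq_lintegral_ofReal]
  · rw [← intervalIntegral.integral_of_le zero_le_one, integral_rpow (Or.inl (by linarith)),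
      Real.one_rpow, Real.zero_rpow (by linarith)]
    congr 1
    ring
  · exact (intervalIntegral.intervalIntegrable_rpow' (by linarith)).1
  · filter_upwards [ae_restrict_mem measurableSet_Ioc] with t ht
    exact Real.rpow_nonneg ht.1.le _

theorem setLIntegral_enorm_sub_le {f : E → ℝ} (hf : ContDiff ℝ 1 f) {S : Set E}
    (hS : MeasurableSet S) (x : E) {q : ℝ} (hq : 1 ≤ q) (hqn : Module.finrank ℝ E < q)
    {L : ℝ≥0∞} (hL : ∀ y ∈ S, ‖y - x‖ₑ ≤ L) :
    ∫⁻ y in S, ‖f x - f y‖ₑ ∂μ ≤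
      L * (ENNReal.ofReal (1 / (1 - Module.finrank ℝ E / q)) *
        (eLpNorm (fderiv ℝ f) (ENNReal.ofReal q) μ * μ S ^ (1 - 1 / q))) := by
  have hc := hf.continuous_fderiv one_ne_zero
  calc ∫⁻ y in S, ‖f x - f y‖ₑ ∂μ
      ≤ ∫⁻ y in S, (∫⁻ t in Set.Ioc (0:ℝ) 1, L * ‖fderiv ℝ f (x + t • (y - x))‖ₑ) ∂μ := by
        refine setLIntegral_mono' hS fun y hy =>
          (enorm_sub_le_lintegral_fderiv hf x y).trans (lintegral_mono fun t => ?_)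
        gcongr
        exact hL y hy
    _ = ∫⁻ t in Set.Ioc (0:ℝ) 1, ∫⁻ y in S, L * ‖fderiv ℝ f (x + t • (y - x))‖ₑ ∂μ := by
        refine lintegral_lintegral_swap (Measurable.aemeasurable ?_)
        refine Measurable.const_mul (Continuous.measurable ?_) _
        fun_prop
    _ ≤ ∫⁻ t in Set.Ioc (0:ℝ) 1, ENNReal.ofReal (t ^ (-(Module.finrank ℝ E / q))) *
          (L * (eLpNorm (fderiv ℝ f) (ENNReal.ofReal q) μ * μ S ^ (1 - 1 / q))) := by
        refine setLIntegral_mono' measurableSet_Ioc fun t ht => ?_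
        rw [lintegral_const_mul _ (Continuous.measurable (by fun_prop)), mul_left_comm]
        gcongr
        exact setLIntegral_enorm_comp_add_smul_sub_le μ hc S x ht.1 hq
    _ = _ := by
        rw [lintegral_mul_const _ (by fun_prop), lintegral_ofReal_rpow_neg
          ((div_lt_one (by linarith)).2 hqn), mul_left_comm]

/-- **Morrey's inequality** for compactly supported `C¹` functions. -/
theorem exists_abs_sub_le_rpow_mul_integral_fderiv {q : ℝ} (hq : 1 ≤ q)
    (hqn : Module.finrank ℝ E < q) :
    ∃ C > 0, ∀ f : E → ℝ, ContDiff ℝ 1 f → HasCompactSupport f → ∀ x z,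
      |f x - f z| ≤ C * dist x z ^ (1 - Module.finrank ℝ E / q) *
        (∫ y, ‖fderiv ℝ f y‖ ^ q ∂μ) ^ (1 / q) := by
  have hq0 : 0 < q := by linarith
  set n : ℕ := Module.finrank ℝ E with hn
  have hnq : (n : ℝ) / q < 1 := (div_lt_one hq0).2 hqn
  set ω : ℝ := (μ (Metric.ball 0 1)).toReal with hω
  have hω0 : 0 < ω := ENNReal.toReal_pos (Metric.measure_ball_pos μ _ one_pos).ne'
    measure_ball_lt_top.ne
  have hI0 : 0 < 1 / (1 - n / q) := one_div_pos.2 (by linarith)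
  refine ⟨4 * (1 / (1 - n / q)) * ω ^ (-(1 / q)), by positivity, fun f hf hfs x z => ?_⟩
  rcases eq_or_ne x z with rfl | hxz
  · simp only [sub_self, abs_zero]
    positivity
  set R := dist x z with hR
  have hR0 : 0 < R := dist_pos.2 hxz
  set N := (∫ y, ‖fderiv ℝ f y‖ ^ q ∂μ) ^ (1 / q) with hN
  have hN0 : 0 ≤ N := by positivity
  have hNe : eLpNorm (fderiv ℝ f) (ENNReal.ofReal q) μ = ENNReal.ofReal N := by
    rw [MemLp.eLpNorm_eq_integral_rpow_norm (by simpa using hq0) ENNReal.ofReal_ne_top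
      ((hf.continuous_fderiv one_ne_zero).memLp_of_hasCompactSupport (hfs.fderiv ℝ)),
      ENNReal.toReal_ofReal hq0.le, hN, one_div]
  set v : ℝ := R ^ n * ω with hv
  have hv0 : 0 < v := by positivity
  have hV : μ (Metric.closedBall x R) = ENNReal.ofReal v := by
    rw [Measure.addHaar_closedBall μ x hR0.le, hv, ENNReal.ofReal_mul (by positivity), hω,
      ENNReal.ofReal_toReal measure_ball_lt_top.ne]
  have key : ∀ w ∈ Metric.closedBall x R, ∫⁻ y in Metric.closedBall x R, ‖f w - f y‖ₑ ∂μ ≤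
      ENNReal.ofReal (2 * R * (1 / (1 - n / q) * (N * v ^ (1 - 1 / q)))) := by
    intro w hw
    refine (setLIntegral_enorm_sub_le μ hf measurableSet_closedBall w hq hqn
      (L := ENNReal.ofReal (2 * R)) fun y hy => ?_).trans (le_of_eq ?_)
    · rw [← ofReal_norm, ← dist_eq_norm]
      refine ENNReal.ofReal_le_ofReal ((dist_triangle_right y w x).trans ?_)
      rw [two_mul]
      exact add_le_add hy hw
    · rw [hNe, hV, ENNReal.ofReal_rpow_of_pos hv0, ← ENNReal.ofReal_mul hN0,
        ← ENNReal.ofReal_mul hI0.le, ← ENNReal.ofReal_mul (by positivity)]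
  have main : ENNReal.ofReal (|f x - f z| * v) ≤
      ENNReal.ofReal (2 * (2 * R * (1 / (1 - n / q) * (N * v ^ (1 - 1 / q))))) := by
    calc ENNReal.ofReal (|f x - f z| * v)
        = ∫⁻ y in Metric.closedBall x R, ‖f x - f z‖ₑ ∂μ := by
          rw [setLIntegral_const, hV, ENNReal.ofReal_mul (abs_nonneg _), Real.enorm_eq_ofReal_abs]
      _ ≤ ∫⁻ y in Metric.closedBall x R, (‖f x - f y‖ₑ + ‖f z - f y‖ₑ) ∂μ := by
          refine lintegral_mono fun y => ?_
          rw [show f x - f z = (f x - f y) - (f z - f y) by ring]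
          exact enorm_sub_le
      _ = (∫⁻ y in Metric.closedBall x R, ‖f x - f y‖ₑ ∂μ)
            + ∫⁻ y in Metric.closedBall x R, ‖f z - f y‖ₑ ∂μ :=
          lintegral_add_left (by have := hf.continuous; fun_prop) _
      _ ≤ _ := by
          rw [two_mul (2 * R * _), ENNReal.ofReal_add (by positivity) (by positivity)]
          exact add_le_add (key x (by simp [hR0.le]))
            (key z (by rw [Metric.mem_closedBall, dist_comm]))
  rw [ENNReal.ofReal_le_ofReal_iff (by positivity)] at main
  have hvq : v ^ (1 - 1 / q) = v * (R ^ (-(n / q)) * ω ^ (-(1 / q))) := by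
    rw [sub_eq_add_neg, Real.rpow_add hv0, Real.rpow_one]
    congr 1
    rw [hv, Real.mul_rpow (by positivity) hω0.le, ← Real.rpow_natCast, ← Real.rpow_mul hR0.le]
    congr 2
    ring
  have hRR : R ^ (1 - n / q) = R * R ^ (-(n / q)) := by
    rw [sub_eq_add_neg, Real.rpow_add hR0, Real.rpow_one]
  rw [hvq] at main
  rw [hRR]
  refine le_of_mul_le_mul_right (main.trans (le_of_eq ?_)) hv0
  ring

end Morrey

theorem abs_sub_le_rpow_mul_of_abs_deriv_le {φ φ' N : ℝ → ℝ} {c p T : ℝ} (hp : 1 < p)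
    (hφ : ∀ t, HasDerivAt φ (φ' t) t) (hφ' : Continuous φ') (hN : Continuous N)
    (hN0 : ∀ t, 0 ≤ N t) (hc : 0 ≤ c) (hle : ∀ t, |φ' t| ≤ c * N t)
    {a b : ℝ} (ha : a ∈ Set.Icc 0 T) (hb : b ∈ Set.Icc 0 T) :
    |φ b - φ a| ≤ c * (|b - a| ^ (1 - 1 / p) *
      (∫ t in Set.Icc 0 T, N t ^ p) ^ (1 / p)) := by
  wlog hab : a ≤ b generalizing a b
  · rw [abs_sub_comm (φ b), abs_sub_comm b]
    exact this hb ha (le_of_not_ge hab)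
  have hp0 : 0 < p := by linarith
  have hpq : p.HolderConjugate p.conjExponent := Real.HolderConjugate.conjExponent hp
  have hq : 1 / p.conjExponent = 1 - 1 / p := by
    rw [one_div, one_div, hpq.one_sub_inv]
  have hNp : Continuous fun t => N t ^ p := hN.rpow_const fun _ => Or.inr hp0.le
  have hmem : MemLp N (ENNReal.ofReal p) (volume.restrict (Set.Ioc a b)) := by
    rw [← integrable_norm_rpow_iff hN.aestronglyMeasurable (by simpa using hp0)
      ENNReal.ofReal_ne_top, ENNReal.toReal_ofReal hp0.le]
    have h := (hNp.continuousOn (s := Set.Icc a b)).integrableOn_compact (μ := volume)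
      isCompact_Icc
    simp only [Real.norm_of_nonneg (hN0 _)]
    exact h.mono_set Set.Ioc_subset_Icc_self
  have h1 : ∫ t in Set.Ioc a b, N t ≤
      (∫ t in Set.Ioc a b, N t ^ p) ^ (1 / p) * |b - a| ^ (1 - 1 / p) := by
    have := integral_mul_le_Lp_mul_Lq_of_nonneg (μ := volume.restrict (Set.Ioc a b)) hpq
      (f := N) (g := fun _ => 1) (ae_of_all _ hN0) (ae_of_all _ fun _ => zero_le_one) hmem
      (memLp_const 1)
    simpa [hq, abs_of_nonneg (sub_nonneg.2 hab), hab] using this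
  have h2 : ∫ t in Set.Ioc a b, N t ^ p ≤ ∫ t in Set.Icc 0 T, N t ^ p :=
    setIntegral_mono_set (hNp.continuousOn.integrableOn_compact isCompact_Icc)
      (ae_of_all _ fun t => Real.rpow_nonneg (hN0 t) _)
      (Set.Ioc_subset_Icc_self.trans (Set.Icc_subset_Icc ha.1 hb.2)).eventuallyLE
  have h3 : |φ b - φ a| ≤ c * ∫ t in Set.Ioc a b, N t := by
    rw [← intervalIntegral.integral_eq_sub_of_hasDerivAt (fun t _ => hφ t)
      (hφ'.intervalIntegrable a b), ← intervalIntegral.integral_of_le hab,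
      ← intervalIntegral.integral_const_mul]
    exact intervalIntegral.norm_integral_le_of_norm_le (f := φ') hab
      (ae_of_all _ fun t _ => hle t)
      ((hN.const_mul c).intervalIntegrable a b)
  refine h3.trans (mul_le_mul_of_nonneg_left (h1.trans ?_) hc)
  rw [mul_comm]
  gcongr
  exact setIntegral_nonneg measurableSet_Ioc fun t _ => Real.rpow_nonneg (hN0 t) _

section MixedDerivative

variable {E : Type*} [NormedAddCommGroup E] [NormedSpace ℝ E] {σ : ℝ → E → ℝ}

theorem hasFDerivAt_of_uncurry (hσ : Differentiable ℝ (Function.uncurry σ)) (t : ℝ) (y : E) :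
    HasFDerivAt (σ t)
      ((fderiv ℝ (Function.uncurry σ) (t, y)).comp (ContinuousLinearMap.inr ℝ ℝ E)) y :=
  (hσ (t, y)).hasFDerivAt.comp y (hasFDerivAt_prodMk_right t y)

theorem hasDerivAt_of_uncurry (hσ : Differentiable ℝ (Function.uncurry σ)) (t : ℝ) (y : E) :
    HasDerivAt (fun τ => σ τ y) (fderiv ℝ (Function.uncurry σ) (t, y) (1, 0)) t :=
  (hσ (t, y)).hasFDerivAt.comp_hasDerivAt (f := fun τ => (τ, y)) t
    ((hasDerivAt_id t).prodMk (hasDerivAt_const t y))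

theorem contDiff_uncurry_deriv (hσ : ContDiff ℝ 2 (Function.uncurry σ)) :
    ContDiff ℝ 1 (Function.uncurry fun t y => deriv (fun τ => σ τ y) t) := by
  have h : (Function.uncurry fun t y => deriv (fun τ => σ τ y) t) =
      fun p => fderiv ℝ (Function.uncurry σ) p (1, 0) := by
    ext ⟨t, y⟩
    exact (hasDerivAt_of_uncurry (hσ.differentiable two_ne_zero) t y).deriv
  rw [h]
  exact (hσ.fderiv_right (m := 1) (by norm_num)).clm_apply contDiff_const

theorem deriv_fderiv_eq_fderiv_deriv (hσ : ContDiff ℝ 2 (Function.uncurry σ)) (t : ℝ) (y : E) :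
    deriv (fun τ => fderiv ℝ (σ τ) y) t = fderiv ℝ (fun y => deriv (fun τ => σ τ y) t) y := by
  have hd := hσ.differentiable two_ne_zero
  have hd2 : Differentiable ℝ (fderiv ℝ (Function.uncurry σ)) :=
    (hσ.fderiv_right (m := 1) (by norm_num)).differentiable one_ne_zero
  have h1 : (fun τ => fderiv ℝ (σ τ) y) = fun τ =>
      (fderiv ℝ (Function.uncurry σ) (τ, y)).comp (ContinuousLinearMap.inr ℝ ℝ E) :=
    funext fun τ => (hasFDerivAt_of_uncurry hd τ y).fderiv
  have h2 : (fun y => deriv (fun τ => σ τ y) t) =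
      fun y => fderiv ℝ (Function.uncurry σ) (t, y) (1, 0) :=
    funext fun y => (hasDerivAt_of_uncurry hd t y).deriv
  have h3 : HasDerivAt (fun τ => fderiv ℝ (Function.uncurry σ) (τ, y))
      (fderiv ℝ (fderiv ℝ (Function.uncurry σ)) (t, y) (1, 0)) t :=
    (hd2 (t, y)).hasFDerivAt.comp_hasDerivAt t
      ((hasDerivAt_id t).prodMk (hasDerivAt_const t y))
  have h4 : HasFDerivAt (fun y => fderiv ℝ (Function.uncurry σ) (t, y))
      ((fderiv ℝ (fderiv ℝ (Function.uncurry σ)) (t, y)).comp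
        (ContinuousLinearMap.inr ℝ ℝ E)) y :=
    (hd2 (t, y)).hasFDerivAt.comp y (hasFDerivAt_prodMk_right t y)
  have hs : IsSymmSndFDerivAt ℝ (Function.uncurry σ) (t, y) :=
    hσ.contDiffAt.isSymmSndFDerivAt (by simp)
  rw [h1, h2, (h3.clm_comp (hasDerivAt_const t _)).deriv,
    (h4.clm_apply (hasFDerivAt_const _ y)).fderiv]
  ext w
  simpa using hs.eq (1, 0) (0, w)

theorem continuous_uncurry_deriv_fderiv (hσ : ContDiff ℝ 2 (Function.uncurry σ)) :
    Continuous (Function.uncurry fun t y => deriv (fun τ => fderiv ℝ (σ τ) y) t) := by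
  have hg := contDiff_uncurry_deriv hσ
  have h : (Function.uncurry fun t y => deriv (fun τ => fderiv ℝ (σ τ) y) t) = fun p =>
      (fderiv ℝ (Function.uncurry fun t y => deriv (fun τ => σ τ y) t) p).comp
        (ContinuousLinearMap.inr ℝ ℝ E) := by
    ext1 ⟨t, y⟩
    exact (deriv_fderiv_eq_fderiv_deriv hσ t y).trans
      (hasFDerivAt_of_uncurry (hg.differentiable one_ne_zero) t y).fderiv
  rw [h]
  exact (hg.continuous_fderiv one_ne_zero).clm_comp continuous_const

end MixedDerivative

/-- Hölder-type estimate in space and time for a `C²` coefficient `σ` supported on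
`[0,T] × K`, in terms of mixed Lebesgue norms of `σ` and its partial derivatives:
`|σ(r,x) - σ(u,z)| ≤ C(|x-z|^s (‖∂_t∇_zσ‖ + ‖∇_zσ‖) + |r-u|^{s₂} (‖∂_t∇_zσ‖ + ‖∂_tσ‖))`. -/
theorem stmt5 (d : ℕ) (hd : 1 ≤ d) (s s₂ q q₂ T : ℝ)
    (hs : s ∈ Set.Ioo (0:ℝ) 1) (hs₂ : s₂ ∈ Set.Ioo (0:ℝ) 1)
    (hq : q > (d : ℝ) / (1 - s)) (hq₂ : q₂ > 1 / (1 - s₂)) (hT : 0 < T)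
    (K : Set (EuclideanSpace ℝ (Fin d))) (hK : IsCompact K) (hK0 : 0 < volume K) :
    ∃ C > 0, ∀ σ : ℝ → EuclideanSpace ℝ (Fin d) → ℝ,
      ContDiff ℝ 2 (Function.uncurry σ) →
      (∀ t x, (t, x) ∉ Set.Icc (0:ℝ) T ×ˢ K → σ t x = 0) →
      ∀ r ∈ Set.Icc (0:ℝ) T, ∀ u ∈ Set.Icc (0:ℝ) T, ∀ x ∈ K, ∀ z ∈ K,
        |σ r x - σ u z| ≤
          C * (dist x z ^ s *
              (mnorm d T q₂ q K (fun t y => ‖deriv (fun τ => fderiv ℝ (σ τ) y) t‖) +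
               mnorm d T q₂ q K (fun t y => ‖fderiv ℝ (σ t) y‖)) +
            |r - u| ^ s₂ *
              (mnorm d T q₂ q K (fun t y => ‖deriv (fun τ => fderiv ℝ (σ τ) y) t‖) +
               mnorm d T q₂ q K (fun t y => |deriv (fun τ => σ τ y) t|))) := by
  obtain ⟨hs0, hs1⟩ := hs
  obtain ⟨hs₂0, hs₂1⟩ := hs₂
  have hd1 : (1:ℝ) ≤ d := by exact_mod_cast hd
  have hdq : (d : ℝ) < q * (1 - s) := (div_lt_iff₀ (by linarith)).1 hq
  have hq0 : 0 < q := (div_pos (by linarith) (by linarith)).trans hq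
  have hdq' : (d : ℝ) < q := by nlinarith
  have hsa : s < 1 - d / q := by
    have : (d : ℝ) / q < 1 - s := (div_lt_iff₀ hq0).2 (by linarith)
    linarith
  have h1q₂ : 1 < q₂ * (1 - s₂) := (div_lt_iff₀ (by linarith)).1 hq₂
  have hq₂0 : 0 < q₂ := (div_pos one_pos (by linarith)).trans hq₂
  have hq₂1 : 1 < q₂ := by nlinarith
  have hsb : s₂ < 1 - 1 / q₂ := by
    have : 1 / q₂ < 1 - s₂ := (div_lt_iff₀ hq₂0).2 (by linarith)
    linarith
  have : Nonempty (Fin d) := ⟨⟨0, hd⟩⟩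
  obtain ⟨C₀, hC₀, hM⟩ := exists_abs_sub_le_rpow_mul_integral_fderiv
    (volume : Measure (EuclideanSpace ℝ (Fin d))) (q := q) (by linarith) (by simpa using hdq')
  simp only [finrank_euclideanSpace_fin] at hM
  obtain ⟨M, hM0, hKM⟩ := hK.isBounded.exists_pos_norm_le
  obtain ⟨z₀, hz₀⟩ := NormedSpace.exists_lt_norm ℝ (EuclideanSpace ℝ (Fin d)) M
  have hz₀K : z₀ ∉ K := fun h => (hKM z₀ h).not_gt hz₀
  set D := M + ‖z₀‖ with hD
  have hD0 : 0 < D := by positivity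
  have hDz₀ : ∀ z ∈ K, dist z z₀ ≤ D := fun z hz =>
    (dist_le_norm_add_norm z z₀).trans (by linarith [hKM z hz])
  have hDK : ∀ x ∈ K, ∀ z ∈ K, dist x z ≤ D := fun x hx z hz =>
    (dist_le_norm_add_norm x z).trans (by linarith [hKM x hx, hKM z hz])
  set a : ℝ := 1 - d / q with ha
  set b : ℝ := 1 - 1 / q₂ with hb
  refine ⟨C₀ * (D ^ (a - s) * T ^ b + D ^ a * T ^ (b - s₂)), by positivity, ?_⟩
  intro σ hσ hσ0 r hr u hu x hx z hz
  have hdiff := hσ.differentiable two_ne_zero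
  set g : ℝ → EuclideanSpace ℝ (Fin d) → ℝ := fun t y => deriv (fun τ => σ τ y) t with hg
  have hgC : ContDiff ℝ 1 (Function.uncurry g) := contDiff_uncurry_deriv hσ
  have hgt : ∀ t, ContDiff ℝ 1 (g t) := fun t => hgC.comp (contDiff_prodMk_right t)
  have hg0 : ∀ t, ∀ y ∉ K, g t y = 0 := fun t y hy => by
    have : (fun τ => σ τ y) = fun _ => 0 := funext fun τ => hσ0 τ y fun h => hy h.2
    simp [hg, this]
  have hgs : ∀ t, HasCompactSupport (g t) := fun t => HasCompactSupport.intro hK (hg0 t)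
  set G : ℝ → EuclideanSpace ℝ (Fin d) → EuclideanSpace ℝ (Fin d) →L[ℝ] ℝ :=
    fun t y => deriv (fun τ => fderiv ℝ (σ τ) y) t with hG
  have hGc : Continuous (Function.uncurry G) := continuous_uncurry_deriv_fderiv hσ
  have hGg : ∀ t y, fderiv ℝ (g t) y = G t y := fun t y =>
    (deriv_fderiv_eq_fderiv_deriv hσ t y).symm
  have hG0 : ∀ t, ∀ y ∉ K, G t y = 0 := fun t y hy => by
    rw [← hGg]
    have : g t =ᶠ[nhds y] fun _ => 0 := by
      filter_upwards [hK.isClosed.isOpen_compl.mem_nhds hy] with w hw using hg0 t w hw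
    rw [this.fderiv_eq]
    simp
  set N : ℝ → ℝ := fun t => (∫ y in K, ‖G t y‖ ^ q) ^ (1 / q) with hN
  have hN0 : ∀ t, 0 ≤ N t := fun t => by positivity
  have hNc : Continuous N := by
    refine Continuous.rpow_const (continuous_parametric_integral_of_continuous ?_ hK)
      fun _ => Or.inr (by positivity)
    exact hGc.norm.rpow_const fun _ => Or.inr hq0.le
  have hMor : ∀ t y w, |g t y - g t w| ≤ C₀ * dist y w ^ a * N t := fun t y w => by
    have h := hM (g t) (hgt t) (hgs t) y w
    simp only [hGg] at h
    rwa [← setIntegral_eq_integral_of_forall_compl_eq_zero (s := K) fun y hy => by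
      rw [hG0 t y hy, norm_zero, Real.zero_rpow hq0.ne']] at h
  have hmix : mnorm d T q₂ q K (fun t y => ‖G t y‖) =
      (∫ t in Set.Icc 0 T, N t ^ q₂) ^ (1 / q₂) := by
    simp only [mnorm, abs_norm, hN]
    congr 2 with t
    rw [← Real.rpow_mul (by positivity)]
    congr 1
    ring
  have hmnn : ∀ h : ℝ → EuclideanSpace ℝ (Fin d) → ℝ, 0 ≤ mnorm d T q₂ q K h := fun h => by
    unfold mnorm
    positivity
  set A := mnorm d T q₂ q K (fun t y => ‖G t y‖)
  have hA0 : 0 ≤ A := hmnn _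
  have hσt : ∀ y t, HasDerivAt (fun τ => σ τ y) (g t y) t := fun y t =>
    (hasDerivAt_of_uncurry hdiff t y).differentiableAt.hasDerivAt
  have hgy : ∀ y, Continuous fun t => g t y := fun y =>
    hgC.continuous.comp (Continuous.prodMk_left y)
  have hσ00 : ∀ y, σ 0 y = 0 := fun y => by
    have hc : Continuous fun τ => σ τ y := hσ.continuous.comp (Continuous.prodMk_left y)
    refine tendsto_nhds_unique ((hc.tendsto 0).mono_left (nhdsWithin_le_nhds (s := Set.Iio 0)))
      (tendsto_const_nhds.congr' ?_)
    filter_upwards [self_mem_nhdsWithin] with t ht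
    exact (hσ0 t y fun h => (not_le.2 ht) h.1.1).symm
  have hspace : |σ r x - σ r z| ≤ C₀ * dist x z ^ a * (T ^ b * A) := by
    have h := abs_sub_le_rpow_mul_of_abs_deriv_le (φ := fun t => σ t x - σ t z) hq₂1
      (fun t => (hσt x t).sub (hσt z t)) ((hgy x).sub (hgy z)) hNc hN0 (by positivity)
      (fun t => hMor t x z) (Set.left_mem_Icc.2 hT.le) hr
    rw [← hmix] at h
    simp only [hσ00, sub_zero] at h
    refine h.trans ?_
    rw [abs_of_nonneg hr.1]
    gcongr ?_ * (?_ * _)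
    exact Real.rpow_le_rpow hr.1 hr.2 (by linarith)
  have htime : |σ r z - σ u z| ≤ C₀ * D ^ a * (|r - u| ^ b * A) := by
    rw [hmix]
    refine abs_sub_le_rpow_mul_of_abs_deriv_le hq₂1 (hσt z) (hgy z) hNc hN0 (by positivity)
      (fun t => ?_) hu hr
    have h := hMor t z z₀
    rw [hg0 t z₀ hz₀K, sub_zero] at h
    refine h.trans ?_
    have := hN0 t
    gcongr ?_ * ?_ * _
    exact Real.rpow_le_rpow dist_nonneg (hDz₀ z hz) (by linarith)
  have hsplit : ∀ {y B e e' : ℝ}, 0 ≤ y → y ≤ B → 0 < e → e < e' →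
      y ^ e' ≤ B ^ (e' - e) * y ^ e := fun {y B e e'} hy hyB he hee => by
    have : y ^ e' = y ^ (e' - e) * y ^ e := by
      rw [← Real.rpow_add_of_nonneg hy (by linarith) he.le, sub_add_cancel]
    rw [this]
    gcongr
  have hxz := hsplit dist_nonneg (hDK x hx z hz) hs0 hsa
  have hru := hsplit (abs_nonneg (r - u)) (show |r - u| ≤ T from abs_sub_le_iff.2
    ⟨by linarith [hr.2, hu.1], by linarith [hr.1, hu.2]⟩) hs₂0 hsb
  have hB1 := hmnn fun t y => ‖fderiv ℝ (σ t) y‖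
  have hB2 := hmnn fun t y => |g t y|
  set B₁ := mnorm d T q₂ q K fun t y => ‖fderiv ℝ (σ t) y‖
  set B₂ := mnorm d T q₂ q K fun t y => |g t y|
  set α := D ^ (a - s) * T ^ b with hα
  set β := D ^ a * T ^ (b - s₂) with hβ
  have hα0 : 0 ≤ α := by positivity
  have hβ0 : 0 ≤ β := by positivity
  calc |σ r x - σ u z| ≤ |σ r x - σ r z| + |σ r z - σ u z| := abs_sub_le _ _ _
    _ ≤ C₀ * (D ^ (a - s) * dist x z ^ s) * (T ^ b * A) +
        C₀ * D ^ a * (T ^ (b - s₂) * |r - u| ^ s₂ * A) := by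
      refine add_le_add (hspace.trans ?_) (htime.trans ?_) <;> gcongr
    _ = C₀ * (α * (dist x z ^ s * A) + β * (|r - u| ^ s₂ * A)) := by
      rw [hα, hβ]
      ring
    _ ≤ C₀ * ((α + β) * (dist x z ^ s * (A + B₁)) + (α + β) * (|r - u| ^ s₂ * (A + B₂))) := by
      gcongr <;> linarith
    _ = _ := by ring
end

section
/- Let T > 0, α ∈ (0,1), and let h : [0,T] → ℝ be Lebesgue integrable. Define F(t) = ∫_0^t h(u) du. Then for every t ∈ [0,T], |F(t)| + ∫_0^t |F(t) - F(s)| / (t-s)^{α+1} ds ≤ (T^α + 1/α) ∫_0^t |h(u)| (t-u)^{-α} du. -/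
open MeasureTheory
open scoped ENNReal

/-- The integral of the kernel `(t - s) ^ (-(α + 1))` over `(0, u]` is at most
`(t - u) ^ (-α) / α`. -/
lemma lintegral_Ioc_sub_rpow_le {α t u : ℝ} (hα : 0 < α) (hu : 0 < u) (hut : u < t) :
    ∫⁻ s in Set.Ioc (0 : ℝ) u, ENNReal.ofReal ((t - s) ^ (-(α + 1))) ≤
      ENNReal.ofReal (1 / α) * ENNReal.ofReal ((t - u) ^ (-α)) := by
  have hcont : ContinuousOn (fun s : ℝ => (t - s) ^ (-(α + 1))) (Set.Icc 0 u) :=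
    ContinuousOn.rpow_const (by fun_prop) fun s hs => Or.inl (by linarith [hs.2])
  have hint : IntegrableOn (fun s : ℝ => (t - s) ^ (-(α + 1))) (Set.Ioc 0 u) :=
    (hcont.integrableOn_Icc).mono_set Set.Ioc_subset_Icc_self
  rw [← ofReal_integral_eq_lintegral_ofReal hint
    ((ae_restrict_iff' measurableSet_Ioc).2 <| .of_forall fun s hs =>
      Real.rpow_nonneg (by linarith [hs.2]) _),
    ← ENNReal.ofReal_mul (by positivity), ← intervalIntegral.integral_of_le hu.le,
    intervalIntegral.integral_comp_sub_left (fun x : ℝ => x ^ (-(α + 1))),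
    integral_rpow (Or.inr ⟨by linarith, by
      rw [Set.uIcc_of_le (by linarith)]; intro hmem; linarith [hmem.1]⟩)]
  apply ENNReal.ofReal_le_ofReal
  have ht : 0 ≤ (t - 0) ^ (-α) := Real.rpow_nonneg (by linarith) _
  rw [show -(α + 1) + 1 = -α by ring, div_neg, ← neg_div, one_div_mul_eq_div]
  gcongr
  linarith

theorem stmt7 (T α : ℝ) (hT : 0 < T) (hα : α ∈ Set.Ioo (0:ℝ) 1)
    (h : ℝ → ℝ) (hh : IntegrableOn h (Set.Icc 0 T)) :
    ∀ t ∈ Set.Icc (0:ℝ) T,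
      ENNReal.ofReal |∫ u in (0:ℝ)..t, h u| +
        ∫⁻ s in Set.Ioc (0:ℝ) t,
          ENNReal.ofReal
            (|(∫ u in (0:ℝ)..t, h u) - ∫ u in (0:ℝ)..s, h u| / (t - s) ^ (α + 1)) ≤
      ENNReal.ofReal (T ^ α + 1 / α) *
        ∫⁻ u in Set.Ioc (0:ℝ) t, ENNReal.ofReal (|h u| * (t - u) ^ (-α)) := by
  intro t ⟨ht0, htT⟩
  have hα0 := hα.1
  have hint : ∀ s ∈ Set.Icc (0 : ℝ) t, ∀ r ∈ Set.Icc (0 : ℝ) t, IntervalIntegrable h volume s r :=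
    fun s hs r hr => (intervalIntegrable_iff.2 <| hh.mono_set fun x hx =>
      have hx' := Set.uIcc_subset_Icc hs hr (Set.uIoc_subset_uIcc hx)
      ⟨hx'.1, hx'.2.trans htT⟩)
  have abs_integral_le : ∀ s r : ℝ, s ≤ r → ENNReal.ofReal |∫ u in s..r, h u| ≤
      ∫⁻ u in Set.Ioc s r, ENNReal.ofReal |h u| := by
    intro s r hsr
    simp only [← Real.enorm_eq_ofReal_abs]
    rw [intervalIntegral.integral_of_le hsr]
    exact enorm_integral_le_lintegral_enorm _
  have ae_lt : ∀ᵐ u ∂volume.restrict (Set.Ioc (0 : ℝ) t), 0 < u ∧ u < t := by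
    rw [ae_restrict_iff' measurableSet_Ioc]
    filter_upwards [Measure.ae_ne volume t] with u hne hu
    exact ⟨hu.1, lt_of_le_of_ne hu.2 hne⟩
  rw [ENNReal.ofReal_add (by positivity) (by positivity), add_mul]
  refine add_le_add ((abs_integral_le 0 t ht0).trans ?_) ?_
  · rw [← lintegral_const_mul' _ _ ENNReal.ofReal_ne_top]
    refine lintegral_mono_ae ?_
    filter_upwards [ae_lt] with u hu
    rw [← ENNReal.ofReal_mul (by positivity)]
    apply ENNReal.ofReal_le_ofReal
    have hpos : 0 < t - u := by linarith [hu.2]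
    have hone : 1 ≤ T ^ α * (t - u) ^ (-α) := by
      rw [Real.rpow_neg hpos.le, ← div_eq_mul_inv, one_le_div (by positivity)]
      exact Real.rpow_le_rpow hpos.le (by linarith [hu.1]) hα0.le
    nlinarith [mul_le_mul_of_nonneg_left hone (abs_nonneg (h u))]
  set μ := volume.restrict (Set.Ioc (0 : ℝ) t)
  let k : ℝ → ℝ≥0∞ := fun s => ENNReal.ofReal ((t - s) ^ (-(α + 1)))
  have hk : Measurable k := by fun_prop
  have hm : AEMeasurable (fun u => ENNReal.ofReal |h u|) μ := by
    have : AEMeasurable h μ :=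
      (hh.mono_set (Set.Ioc_subset_Icc_self.trans
        (Set.Icc_subset_Icc_right htT))).aestronglyMeasurable.aemeasurable
    simpa only [← Real.enorm_eq_ofReal_abs] using this.enorm
  let g : ℝ → ℝ → ℝ≥0∞ := fun s u =>
    Set.indicator {p : ℝ × ℝ | p.1 < p.2} (fun p => ENNReal.ofReal |h p.2| * k p.1) (s, u)
  have hg : AEMeasurable (Function.uncurry g) (μ.prod μ) :=
    ((hm.comp_snd).mul (hk.comp measurable_fst).aemeasurable).indicator
      (measurableSet_lt measurable_fst measurable_snd)
  calc _ ≤ ∫⁻ s, ∫⁻ u, g s u ∂μ ∂μ := by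
        refine lintegral_mono_ae ?_
        filter_upwards [ae_lt] with s hs
        have hpos : 0 < t - s := by linarith [hs.2]
        rw [intervalIntegral.integral_interval_sub_left
          (hint 0 ⟨le_rfl, ht0⟩ t ⟨ht0, le_rfl⟩) (hint 0 ⟨le_rfl, ht0⟩ s ⟨hs.1.le, hs.2.le⟩),
          div_eq_mul_inv, ← Real.rpow_neg hpos.le, ENNReal.ofReal_mul (abs_nonneg _)]
        calc _ ≤ (∫⁻ u in Set.Ioc s t, ENNReal.ofReal |h u|) * k s := by
              gcongr
              exact abs_integral_le s t hs.2.le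
          _ = ∫⁻ u in Set.Ioc s t, g s u := by
              rw [← lintegral_mul_const' _ _ ENNReal.ofReal_ne_top]
              refine setLIntegral_congr_fun measurableSet_Ioc fun u hu => ?_
              exact (Set.indicator_of_mem (s := {p : ℝ × ℝ | p.1 < p.2}) (a := (s, u)) hu.1
                fun p => ENNReal.ofReal |h p.2| * k p.1).symm
          _ ≤ _ := lintegral_mono_set (Set.Ioc_subset_Ioc_left hs.1.le)
    _ = ∫⁻ u, ∫⁻ s, g s u ∂μ ∂μ := lintegral_lintegral_swap hg
    _ ≤ ∫⁻ u, ENNReal.ofReal (1 / α) * ENNReal.ofReal (|h u| * (t - u) ^ (-α)) ∂μ := by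
        refine lintegral_mono_ae ?_
        filter_upwards [ae_lt] with u hu
        calc _ ≤ ∫⁻ s in Set.Ioc 0 t, Set.indicator (Set.Iic u)
                (fun s => ENNReal.ofReal |h u| * k s) s := by
              refine lintegral_mono fun s => ?_
              by_cases hsu : s < u
              · simp [g, hsu, hsu.le]
              · simp [g, hsu]
          _ = ENNReal.ofReal |h u| * ∫⁻ s in Set.Ioc 0 u, k s := by
              rw [lintegral_indicator measurableSet_Iic,
                Measure.restrict_restrict measurableSet_Iic,
                lintegral_const_mul' _ _ ENNReal.ofReal_ne_top, Set.inter_comm,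
                Set.Ioc_inter_Iic, min_eq_right hu.2.le]
          _ ≤ ENNReal.ofReal |h u| *
                (ENNReal.ofReal (1 / α) * ENNReal.ofReal ((t - u) ^ (-α))) := by
              gcongr
              exact lintegral_Ioc_sub_rpow_le hα0 hu.1 hu.2
          _ = _ := by
              rw [ENNReal.ofReal_mul (abs_nonneg _), mul_left_comm]
    _ = _ := lintegral_const_mul' _ _ ENNReal.ofReal_ne_top
end

section
/- Let d ≥ 1, N > 0, T > 0, K = [-N,N]^d, s ∈ (0,1), α ∈ (0, 1/2), q > d/(1-s), ρ > 1/(1-α) with q ≥ ρ. There exists a constant C = C(d, N, T, α, s, ρ, q) such that for every continuously differentiable b : ℝ × ℝ^d → ℝ vanishing outside [0,T] × K and every continuous path x : [0,T] → K, the function F(t) = ∫_0^t b(u, x(u)) du satisfies ‖F‖_{α,∞} ≤ C ( ‖∇_z b‖_{(ρ,q)} + ‖b‖_{(ρ,q)} ). -/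
open MeasureTheory
open scoped ENNReal

/-- The cube `K = [-N,N]^d`. -/
def cube (d : ℕ) (N : ℝ) : Set (EuclideanSpace ℝ (Fin d)) :=
  {v | ∀ i, v i ∈ Set.Icc (-N) N}

/-- Hölder's inequality on a compact set, against the constant function `1`. -/
theorem setIntegral_le_measure_rpow_mul_of_isCompact {X : Type*} [TopologicalSpace X]
    [MeasurableSpace X] [T2Space X] [OpensMeasurableSpace X] {μ : Measure X}
    [IsFiniteMeasureOnCompacts μ] {S : Set X} (hS : IsCompact S) {g : X → ℝ}
    (hg : Continuous g) (hg0 : ∀ y, 0 ≤ g y) {p : ℝ} (hp : 1 < p) :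
    ∫ y in S, g y ∂μ ≤ μ.real S ^ (1 - 1 / p) * (∫ y in S, g y ^ p ∂μ) ^ (1 / p) := by
  have hconj := Real.HolderConjugate.conjExponent hp
  have : IsFiniteMeasure (μ.restrict S) := isFiniteMeasure_restrict.2 hS.measure_lt_top.ne
  obtain ⟨c, hc⟩ := hS.exists_bound_of_continuousOn hg.continuousOn
  have hmem : MemLp g (ENNReal.ofReal p) (μ.restrict S) := by
    refine MemLp.of_bound ?_ c ((ae_restrict_iff' hS.measurableSet).2 (ae_of_all _ hc))
    exact (hg.continuousOn (s := S)).aestronglyMeasurable_of_isCompact hS hS.measurableSet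
  have key := integral_mul_le_Lp_mul_Lq_of_nonneg hconj (μ := μ.restrict S)
    (f := g) (g := fun _ ↦ (1 : ℝ)) (ae_of_all _ hg0) (ae_of_all _ fun _ ↦ zero_le_one) hmem
    (memLp_const 1)
  have hexp : 1 / p.conjExponent = 1 - 1 / p := by
    rw [one_div, one_div, hconj.one_sub_inv]
  simp only [mul_one, Real.one_rpow, hexp, integral_const, smul_eq_mul,
    measureReal_restrict_apply_univ] at key
  rwa [mul_comm] at key

/-- A `C¹` function differs from its value at `x` by at most the integral of its gradient along the
segment from `x` to `x + v`. -/
theorem abs_sub_le_setIntegral_norm_fderiv {E : Type*} [NormedAddCommGroup E] [NormedSpace ℝ E]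
    {f : E → ℝ} (hf : ContDiff ℝ 1 f) (x v : E) (hv : ‖v‖ ≤ 1) :
    |f (x + v) - f x| ≤ ∫ t in Set.Icc (0 : ℝ) 1, ‖fderiv ℝ f (x + t • v)‖ := by
  have hline : ∀ t : ℝ, HasDerivAt (fun t : ℝ ↦ x + t • v) v t := fun t ↦ by
    simpa using ((hasDerivAt_id t).smul_const v).const_add x
  have hcont : Continuous fun t : ℝ ↦ fderiv ℝ f (x + t • v) :=
    (hf.continuous_fderiv one_ne_zero).comp (by fun_prop)
  have hderiv : ∀ t : ℝ, HasDerivAt (fun t : ℝ ↦ f (x + t • v)) (fderiv ℝ f (x + t • v) v) t :=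
    fun t ↦ ((hf.differentiable one_ne_zero _).hasFDerivAt).comp_hasDerivAt t (hline t)
  have hftc := intervalIntegral.integral_eq_sub_of_hasDerivAt (a := 0) (b := 1)
    (fun t _ ↦ hderiv t) ((hcont.clm_apply continuous_const).intervalIntegrable _ _)
  simp only [one_smul, zero_smul, add_zero] at hftc
  rw [← hftc, integral_Icc_eq_integral_Ioc, ← intervalIntegral.integral_of_le zero_le_one,
    ← Real.norm_eq_abs]
  refine intervalIntegral.norm_integral_le_of_norm_le zero_le_one (ae_of_all _ fun t _ ↦ ?_)
    (hcont.norm.intervalIntegrable _ _)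
  exact (ContinuousLinearMap.le_opNorm _ _).trans (mul_le_of_le_one_right (norm_nonneg _) hv)

/-- **Morrey's inequality** for compactly supported functions: if `q` exceeds the dimension, the
`W^{1,q}` norm controls the supremum norm. -/
theorem exists_abs_le_mul_rpow_integral_add {E : Type*} [NormedAddCommGroup E] [NormedSpace ℝ E]
    [FiniteDimensional ℝ E] [MeasurableSpace E] [BorelSpace E] (μ : Measure E)
    [μ.IsAddHaarMeasure] {q : ℝ} (hq1 : 1 < q) (hq : Module.finrank ℝ E < q) :
    ∃ C > 0, ∀ f : E → ℝ, ContDiff ℝ 1 f → HasCompactSupport f → ∀ x,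
      |f x| ≤ C * ((∫ y, ‖fderiv ℝ f y‖ ^ q ∂μ) ^ (1 / q) + (∫ y, |f y| ^ q ∂μ) ^ (1 / q)) := by
  have hq0 : 0 < q := by linarith
  set n := Module.finrank ℝ E
  set B := Metric.closedBall (0 : E) 1
  have hBc : IsCompact B := isCompact_closedBall _ _
  set m := μ.real B
  have hm : 0 < m := ENNReal.toReal_pos
    ((Metric.measure_closedBall_pos μ (0 : E) one_pos).ne') hBc.measure_lt_top.ne
  have hnq : (n : ℝ) / q < 1 := (div_lt_one hq0).2 hq
  set D := (1 - (n : ℝ) / q)⁻¹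
  have hD : 1 ≤ D := (one_le_inv₀ (by linarith)).2 (by
    have : 0 ≤ (n : ℝ) / q := by positivity
    linarith)
  refine ⟨m ^ (1 - 1 / q) * D / m, by positivity, fun f hf hfs x ↦ ?_⟩
  have hscale : ∀ g : E → ℝ, Continuous g → HasCompactSupport g → (∀ y, 0 ≤ g y) →
      ∀ t : ℝ, 0 < t → ∫ v in B, g (x + t • v) ∂μ ≤
        m ^ (1 - 1 / q) * (t ^ (-((n : ℝ) / q)) * (∫ y, g y ^ q ∂μ) ^ (1 / q)) := by
    intro g hg hgs hg0 t ht
    have hgt : Continuous fun v ↦ g (x + t • v) := hg.comp (by fun_prop)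
    refine (setIntegral_le_measure_rpow_mul_of_isCompact hBc hgt (fun _ ↦ hg0 _) hq1).trans ?_
    gcongr
    have hpow : Integrable (fun y ↦ g y ^ q) μ := by
      refine (hg.rpow_const fun _ ↦ Or.inr hq0.le).integrable_of_hasCompactSupport ?_
      exact hgs.comp_left (g := fun r : ℝ ↦ r ^ q) (Real.zero_rpow hq0.ne')
    have hint : Integrable (fun v ↦ g (x + t • v) ^ q) μ :=
      (hpow.comp_add_left x).comp_smul ht.ne'
    have heq : ∫ v, g (x + t • v) ^ q ∂μ = t ^ (-(n : ℝ)) * ∫ y, g y ^ q ∂μ := by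
      rw [Measure.integral_comp_smul μ (fun v ↦ g (x + v) ^ q) t,
        integral_add_left_eq_self (fun v ↦ g v ^ q) x, smul_eq_mul, abs_of_pos (by positivity),
        Real.rpow_neg ht.le, Real.rpow_natCast]
    have hle := setIntegral_le_integral (s := B) hint
      (ae_of_all _ fun v ↦ Real.rpow_nonneg (hg0 _) q)
    rw [heq] at hle
    refine (Real.rpow_le_rpow (setIntegral_nonneg hBc.measurableSet fun v _ ↦
      Real.rpow_nonneg (hg0 _) q) hle (by positivity)).trans_eq ?_
    rw [Real.mul_rpow (by positivity) (integral_nonneg fun y ↦ Real.rpow_nonneg (hg0 _) q),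
      ← Real.rpow_mul ht.le]
    congr 2
    ring
  have hgc : Continuous fun y ↦ ‖fderiv ℝ f y‖ := (hf.continuous_fderiv one_ne_zero).norm
  have hfc : Continuous fun y ↦ |f y| := hf.continuous.abs
  set A := (∫ y, ‖fderiv ℝ f y‖ ^ q ∂μ) ^ (1 / q)
  set A' := (∫ y, |f y| ^ q ∂μ) ^ (1 / q)
  have hA' : 0 ≤ A' := Real.rpow_nonneg (integral_nonneg fun _ ↦ by positivity) _
  have hfB : ∫ v in B, |f (x + v)| ∂μ ≤ m ^ (1 - 1 / q) * A' := by
    simpa only [one_smul, Real.one_rpow, one_mul] using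
      hscale _ hfc hfs.norm (fun _ ↦ abs_nonneg _) 1 one_pos
  have hjoint : Continuous fun p : E × ℝ ↦ ‖fderiv ℝ f (x + p.2 • p.1)‖ :=
    hgc.comp (by fun_prop)
  have hgB : ∫ v in B, (∫ t in Set.Icc (0 : ℝ) 1, ‖fderiv ℝ f (x + t • v)‖) ∂μ ≤
      m ^ (1 - 1 / q) * D * A := by
    rw [integral_integral_swap (by
      rw [Measure.prod_restrict]
      exact hjoint.continuousOn.integrableOn_compact (hBc.prod isCompact_Icc))]
    have hcont : Continuous fun t : ℝ ↦ ∫ v in B, ‖fderiv ℝ f (x + t • v)‖ ∂μ :=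
      continuous_parametric_integral_of_continuous
        (f := fun (t : ℝ) v ↦ ‖fderiv ℝ f (x + t • v)‖) (hgc.comp (by fun_prop)) hBc
    rw [integral_Icc_eq_integral_Ioc, ← intervalIntegral.integral_of_le zero_le_one]
    have hexp : -1 < -((n : ℝ) / q) := by linarith
    refine (intervalIntegral.integral_mono_on_of_le_Ioo zero_le_one (hcont.intervalIntegrable _ _)
      (((intervalIntegral.intervalIntegrable_rpow' hexp).mul_const A).const_mul
        (m ^ (1 - 1 / q)))
      fun t ht ↦ hscale _ hgc (hfs.fderiv ℝ).norm (fun _ ↦ norm_nonneg _) t ht.1).trans_eq ?_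
    rw [intervalIntegral.integral_const_mul, intervalIntegral.integral_mul_const,
      integral_rpow (Or.inl hexp), Real.one_rpow, Real.zero_rpow (by linarith), sub_zero,
      neg_add_eq_sub, one_div (1 - (n : ℝ) / q), mul_assoc]
  have hpt : ∀ v ∈ B, |f x| ≤ |f (x + v)| +
      ∫ t in Set.Icc (0 : ℝ) 1, ‖fderiv ℝ f (x + t • v)‖ := fun v hv ↦ by
    have h1 := abs_sub_le_setIntegral_norm_fderiv hf x v (by simpa [B] using hv)
    have h2 := abs_sub_abs_le_abs_sub (f x) (f (x + v))
    rw [abs_sub_comm] at h2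
    linarith
  have hi1 : IntegrableOn (fun v ↦ |f (x + v)|) B μ :=
    (hfc.comp (continuous_const.add continuous_id)).continuousOn.integrableOn_compact hBc
  have hi2 : IntegrableOn
      (fun v ↦ ∫ t in Set.Icc (0 : ℝ) 1, ‖fderiv ℝ f (x + t • v)‖) B μ :=
    (continuous_parametric_integral_of_continuous hjoint
      isCompact_Icc).continuousOn.integrableOn_compact hBc
  have hmain := setIntegral_mono_on
    (integrableOn_const hBc.measure_lt_top.ne) (hi1.add hi2) hBc.measurableSet hpt
  simp only [Pi.add_apply] at hmain
  rw [integral_add hi1 hi2, setIntegral_const, smul_eq_mul] at hmain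
  have hfD : m ^ (1 - 1 / q) * A' ≤ m ^ (1 - 1 / q) * D * A' :=
    mul_le_mul_of_nonneg_right (le_mul_of_one_le_right (by positivity) hD) hA'
  rw [div_mul_eq_mul_div, le_div_iff₀ hm, mul_comm]
  linarith

theorem isCompact_cube (d : ℕ) (N : ℝ) : IsCompact (cube d N) := by
  have h : cube d N = (EuclideanSpace.equiv (Fin d) ℝ) ⁻¹'
      (Set.univ.pi fun _ ↦ Set.Icc (-N) N) := by
    ext v
    simp only [cube, Set.mem_preimage, Set.mem_univ_pi, Set.mem_ofPred_eq]
    rfl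
  rw [h]
  exact (EuclideanSpace.equiv (Fin d) ℝ).toHomeomorph.isCompact_preimage.2
    (isCompact_univ_pi fun _ ↦ isCompact_Icc)

/-- Integrating over a subinterval of `[0,T]` the `L^q(K)` norm of the time slices costs a power
of the length of the subinterval. -/
theorem intervalIntegral_rpow_le_mul_mnorm {d : ℕ} {T ρ q : ℝ} (hρ : 1 < ρ) (hq : 0 < q)
    {K : Set (EuclideanSpace ℝ (Fin d))} (hK : IsCompact K)
    {g : ℝ → EuclideanSpace ℝ (Fin d) → ℝ} (hg : Continuous (Function.uncurry g))
    {r t : ℝ} (hr : 0 ≤ r) (hrt : r ≤ t) (ht : t ≤ T) :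
    ∫ u in r..t, (∫ y in K, |g u y| ^ q) ^ (1 / q) ≤
      (t - r) ^ (1 - 1 / ρ) * mnorm d T ρ q K g := by
  have hI0 : ∀ u, 0 ≤ ∫ y in K, |g u y| ^ q := fun u ↦ integral_nonneg fun _ ↦ by positivity
  have hIc : Continuous fun u ↦ ∫ y in K, |g u y| ^ q :=
    continuous_parametric_integral_of_continuous
      (hg.abs.rpow_const fun _ ↦ Or.inr hq.le) hK
  have hc : Continuous fun u ↦ (∫ y in K, |g u y| ^ q) ^ (1 / q) :=
    hIc.rpow_const fun _ ↦ Or.inr (by positivity)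
  have hcρ : Continuous fun u ↦ (∫ y in K, |g u y| ^ q) ^ (ρ / q) :=
    hIc.rpow_const fun _ ↦ Or.inr (by positivity)
  rw [intervalIntegral.integral_of_le hrt, ← integral_Icc_eq_integral_Ioc]
  refine (setIntegral_le_measure_rpow_mul_of_isCompact isCompact_Icc hc
    (fun u ↦ Real.rpow_nonneg (hI0 u) _) hρ).trans ?_
  rw [Real.volume_real_Icc_of_le hrt]
  refine mul_le_mul_of_nonneg_left ?_ (Real.rpow_nonneg (by linarith) _)
  simp only [← Real.rpow_mul (hI0 _), one_div_mul_eq_div]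
  refine Real.rpow_le_rpow (integral_nonneg fun u ↦ Real.rpow_nonneg (hI0 u) _) ?_ (by positivity)
  exact setIntegral_mono_set (hcρ.continuousOn.integrableOn_compact isCompact_Icc)
    (ae_of_all _ fun u ↦ Real.rpow_nonneg (hI0 u) _)
    (Set.Icc_subset_Icc hr ht).eventuallyLE

/-- A function that is Hölder continuous of order `α + β` at the endpoint `t` has a controlled
fractional increment integral of order `α`. -/
theorem lintegral_abs_sub_div_rpow_le {F : ℝ → ℝ} {t M α β : ℝ} (ht : 0 ≤ t) (hM : 0 ≤ M)
    (hβ : 0 < β) (hF : ∀ r ∈ Set.Ioc 0 t, |F t - F r| ≤ (t - r) ^ (α + β) * M) :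
    ∫⁻ r in Set.Ioc (0 : ℝ) t, ENNReal.ofReal (|F t - F r| / (t - r) ^ (α + 1)) ≤
      ENNReal.ofReal (t ^ β / β * M) := by
  have hexp : -1 < β - 1 := by linarith
  have hint : IntervalIntegrable (fun r ↦ (t - r) ^ (β - 1) * M) volume 0 t := by
    have := (intervalIntegral.intervalIntegrable_rpow' hexp (a := 0) (b := t)).comp_sub_left t
    simpa using (this.symm.mul_const M)
  have hval : ∫ r in (0 : ℝ)..t, (t - r) ^ (β - 1) * M = t ^ β / β * M := by
    rw [intervalIntegral.integral_mul_const,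
      intervalIntegral.integral_comp_sub_left (fun r ↦ r ^ (β - 1)) t, sub_self, sub_zero,
      integral_rpow (Or.inl hexp), sub_add_cancel, Real.zero_rpow hβ.ne', sub_zero]
  rw [← hval, intervalIntegral.integral_of_le ht, ofReal_integral_eq_lintegral_ofReal hint.1
    ((ae_restrict_iff' measurableSet_Ioc).2 (ae_of_all _ fun r hr ↦
      mul_nonneg (Real.rpow_nonneg (sub_nonneg.2 hr.2) _) hM))]
  refine setLIntegral_mono' measurableSet_Ioc fun r hr ↦ ENNReal.ofReal_le_ofReal ?_
  rcases hr.2.eq_or_lt with rfl | hlt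
  · simpa using mul_nonneg (Real.rpow_nonneg le_rfl (β - 1)) hM
  · have hpos : 0 < t - r := sub_pos.2 hlt
    rw [div_le_iff₀ (by positivity)]
    refine (hF r hr).trans_eq ?_
    rw [mul_right_comm, ← Real.rpow_add hpos]
    congr 2
    ring

/-- Fractional-norm bound for the drift operator: for `F(t) = ∫_0^t b(u, x(u)) du` with a
continuous path `x` taking values in `K = [-N,N]^d`,
`‖F‖_{α,∞} ≤ C (‖∇_z b‖_{(ρ,q)} + ‖b‖_{(ρ,q)})`, stated pointwise in `t ∈ [0,T]`. -/
theorem stmt9 (d : ℕ) (hd : 1 ≤ d) (N T α s q ρ : ℝ)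
    (hN : 0 < N) (hT : 0 < T) (hα : α ∈ Set.Ioo (0:ℝ) (1/2))
    (hs : s ∈ Set.Ioo (0:ℝ) 1) (hq : q > (d : ℝ) / (1 - s))
    (hρ : ρ > 1 / (1 - α)) (hqρ : q ≥ ρ) :
    ∃ C > 0, ∀ (b : ℝ → EuclideanSpace ℝ (Fin d) → ℝ)
      (x : ℝ → EuclideanSpace ℝ (Fin d)),
      ContDiff ℝ 1 (Function.uncurry b) →
      (∀ t y, (t, y) ∉ Set.Icc (0:ℝ) T ×ˢ cube d N → b t y = 0) →
      Continuous x →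
      (∀ t ∈ Set.Icc (0:ℝ) T, x t ∈ cube d N) →
      ∀ t ∈ Set.Icc (0:ℝ) T,
        ENNReal.ofReal |∫ u in (0:ℝ)..t, b u (x u)| +
          ∫⁻ r in Set.Ioc (0:ℝ) t,
            ENNReal.ofReal
              (|(∫ u in (0:ℝ)..t, b u (x u)) - ∫ u in (0:ℝ)..r, b u (x u)| /
                (t - r) ^ (α + 1)) ≤
        ENNReal.ofReal (C *
          (mnorm d T ρ q (cube d N) (fun τ y => ‖fderiv ℝ (b τ) y‖) +
           mnorm d T ρ q (cube d N) b)) := by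
  obtain ⟨hα0, hα2⟩ := hα
  have h1α : 0 < 1 - α := by linarith
  have hρ1 : 1 < ρ := (one_lt_one_div h1α (by linarith)).trans hρ
  have hρ0 : 0 < ρ := by linarith
  have hq1 : 1 < q := by linarith
  have hdq : (d : ℝ) < q := by
    refine lt_of_le_of_lt ?_ hq
    rw [le_div_iff₀ (by linarith [hs.2])]
    exact mul_le_of_le_one_right (Nat.cast_nonneg d) (by linarith [hs.1])
  set β := 1 - 1 / ρ - α
  have hβ : 0 < β := by
    have : 1 / ρ < 1 - α := (one_div_lt hρ0 h1α).2 hρ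
    linarith
  have hαβ : α + β = 1 - 1 / ρ := by ring
  obtain ⟨C, hC, hmorrey⟩ := exists_abs_le_mul_rpow_integral_add
    (volume : Measure (EuclideanSpace ℝ (Fin d))) hq1 (by simpa using hdq)
  refine ⟨(T ^ (α + β) + T ^ β / β) * C, by positivity, ?_⟩
  intro b x hb hsupp hx _ t ht
  have hK := isCompact_cube d N
  have hzero : ∀ u, ∀ y ∉ cube d N, b u y = 0 := fun u y hy ↦ hsupp u y fun h ↦ hy h.2
  have hbu : ∀ u, ContDiff ℝ 1 (b u) := fun u ↦ hb.comp (contDiff_const.prodMk contDiff_id)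
  have hcs : ∀ u, HasCompactSupport (b u) := fun u ↦ HasCompactSupport.intro hK (hzero u)
  have hzero' : ∀ u, ∀ y ∉ cube d N, fderiv ℝ (b u) y = 0 := fun u y hy ↦ by
    have hsub : tsupport (b u) ⊆ cube d N :=
      closure_minimal (fun z hz ↦ by_contra fun hzK ↦ hz (hzero u z hzK)) hK.isClosed
    by_contra h
    exact hy (hsub (support_fderiv_subset ℝ h))
  have hgrad : Continuous (Function.uncurry fun u y ↦ ‖fderiv ℝ (b u) y‖) := by
    have h : ContDiff ℝ 1 (Function.uncurry
        fun (p : ℝ × EuclideanSpace ℝ (Fin d)) y ↦ b p.1 y) :=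
      hb.comp ((contDiff_fst.comp contDiff_fst).prodMk contDiff_snd)
    exact (h.fderiv (n := 0) contDiff_snd (by simp)).continuous.norm
  set G := mnorm d T ρ q (cube d N) fun τ y ↦ ‖fderiv ℝ (b τ) y‖
  set H := mnorm d T ρ q (cube d N) b
  have hnonneg : ∀ g, 0 ≤ mnorm d T ρ q (cube d N) g := fun g ↦
    Real.rpow_nonneg (integral_nonneg fun u ↦ Real.rpow_nonneg
      (integral_nonneg fun _ ↦ by positivity) _) _
  have hM : 0 ≤ C * (G + H) := mul_nonneg hC.le (add_nonneg (hnonneg _) (hnonneg _))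
  have hbound : ∀ u, |b u (x u)| ≤
      C * ((∫ y in cube d N, |‖fderiv ℝ (b u) y‖| ^ q) ^ (1 / q) +
        (∫ y in cube d N, |b u y| ^ q) ^ (1 / q)) := fun u ↦ by
    have hq0 : q ≠ 0 := by linarith
    rw [setIntegral_eq_integral_of_forall_compl_eq_zero fun y hy ↦ by
        simp [hzero' u y hy, Real.zero_rpow hq0],
      setIntegral_eq_integral_of_forall_compl_eq_zero fun y hy ↦ by
        simp [hzero u y hy, Real.zero_rpow hq0]]
    simpa only [abs_norm] using hmorrey (b u) (hbu u) (hcs u) (x u)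
  have hcont : ∀ g : ℝ → EuclideanSpace ℝ (Fin d) → ℝ, Continuous (Function.uncurry g) →
      Continuous fun u ↦ (∫ y in cube d N, |g u y| ^ q) ^ (1 / q) := fun g hg ↦
    (continuous_parametric_integral_of_continuous
      (hg.abs.rpow_const fun _ ↦ Or.inr (by linarith)) hK).rpow_const
      fun _ ↦ Or.inr (by positivity)
  have hbx : Continuous fun u ↦ b u (x u) := hb.continuous.comp (continuous_id.prodMk hx)
  have hinc : ∀ r, 0 ≤ r → r ≤ t → |∫ u in r..t, b u (x u)| ≤
      (t - r) ^ (α + β) * (C * (G + H)) := fun r hr hrt ↦ by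
    have hi1 := (hcont _ hgrad).intervalIntegrable (μ := volume) r t
    have hi2 := (hcont _ hb.continuous).intervalIntegrable (μ := volume) r t
    have hle := intervalIntegral.norm_integral_le_of_norm_le (f := fun u ↦ b u (x u)) hrt
      (ae_of_all _ fun u _ ↦ hbound u)
        ((hi1.add hi2).const_mul C)
    rw [intervalIntegral.integral_const_mul, intervalIntegral.integral_add hi1 hi2] at hle
    refine hle.trans ?_
    rw [hαβ, mul_left_comm, mul_add ((t - r) ^ _)]
    gcongr
    · exact intervalIntegral_rpow_le_mul_mnorm hρ1 (by linarith) hK hgrad hr hrt ht.2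
    · exact intervalIntegral_rpow_le_mul_mnorm hρ1 (by linarith) hK hb.continuous hr hrt ht.2
  have hfrac := lintegral_abs_sub_div_rpow_le (F := fun t ↦ ∫ u in (0 : ℝ)..t, b u (x u))
    (α := α) ht.1 hM hβ fun r hr ↦ by
      rw [intervalIntegral.integral_interval_sub_left (hbx.intervalIntegrable _ _)
        (hbx.intervalIntegrable _ _)]
      exact hinc r hr.1.le hr.2
  have hsup := hinc 0 le_rfl ht.1
  rw [sub_zero] at hsup
  refine (add_le_add (ENNReal.ofReal_le_ofReal hsup) hfrac).trans ?_
  have ht0 := ht.1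
  rw [← ENNReal.ofReal_add (by positivity) (by positivity), ← add_mul, mul_assoc _ C]
  have htT := ht.2
  have hαβ0 : 0 ≤ α + β := by linarith
  gcongr
end

section
/- For all a, b ∈ (1/2, 1), the function u ↦ ((1+u)^{a-1/2} - u^{a-1/2})((1+u)^{b-1/2} - u^{b-1/2}) is Lebesgue integrable on (0,∞), and ∫_0^∞ ((1+u)^{a-1/2} - u^{a-1/2})((1+u)^{b-1/2} - u^{b-1/2}) du = -1/(a+b) - Γ(-a-b)( Γ(1/2+a)/Γ(1/2-b) + Γ(1/2+b)/Γ(1/2-a) ). -/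
open MeasureTheory

open Set Filter Topology

/-- The beta integral over the unit interval, in real form. -/
lemma setIntegral_Ioo_rpow_mul_one_sub_rpow {s t : ℝ} (hs : 0 < s) (ht : 0 < t) :
    ∫ x in Ioo (0:ℝ) 1, x ^ (s - 1) * (1 - x) ^ (t - 1) =
      Real.Gamma s * Real.Gamma t / Real.Gamma (s + t) := by
  change _ = ProbabilityTheory.beta s t
  rw [ProbabilityTheory.beta_eq_betaIntegralReal s t hs ht,
    Complex.betaIntegral, intervalIntegral.integral_of_le (by norm_num),
    ← integral_Ioc_eq_integral_Ioo, ← RCLike.re_to_complex, ← integral_re]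
  · refine setIntegral_congr_fun measurableSet_Ioc fun x ⟨hx1, hx₂⟩ ↦ ?_
    norm_cast
    rw [← Complex.ofReal_cpow, ← Complex.ofReal_cpow, RCLike.re_to_complex,
      Complex.re_mul_ofReal, Complex.ofReal_re]
    all_goals linarith
  · have h := Complex.betaIntegral_convergent (u := s) (v := t) (by simpa) (by simpa)
    rwa [intervalIntegrable_iff_integrableOn_Ioc_of_le (by simp), IntegrableOn] at h

/-- The beta integral of the second kind. -/
lemma setIntegral_Ioi_one_add_rpow_mul_rpow {s t : ℝ} (hs : 0 < s) (ht : 0 < t) :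
    ∫ u in Ioi (0:ℝ), (1 + u) ^ (-(s + t)) * u ^ (s - 1) =
      Real.Gamma s * Real.Gamma t / Real.Gamma (s + t) := by
  have himg : (fun x : ℝ => x / (1 - x)) '' Ioo 0 1 = Ioi 0 := by
    ext u
    constructor
    · rintro ⟨x, hx, rfl⟩
      exact div_pos hx.1 (sub_pos.2 hx.2)
    · intro hu
      have hu : 0 < u := hu
      refine ⟨u / (1 + u), ⟨by positivity, by rw [div_lt_one (by positivity)]; linarith⟩, ?_⟩
      field_simp
      ring
  have hderiv : ∀ x ∈ Ioo (0:ℝ) 1,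
      HasDerivWithinAt (fun x : ℝ => x / (1 - x)) (1 / (1 - x) ^ 2) (Ioo 0 1) x := by
    intro x hx
    have h1 : 1 - x ≠ 0 := (sub_pos.2 hx.2).ne'
    have h := (hasDerivAt_id x).div ((hasDerivAt_id x).const_sub 1) h1
    refine (h.congr_deriv ?_).hasDerivWithinAt
    simp
  have hinj : InjOn (fun x : ℝ => x / (1 - x)) (Ioo 0 1) := by
    intro x hx y hy hxy
    have h1 : 1 - x ≠ 0 := (sub_pos.2 hx.2).ne'
    have h2 : 1 - y ≠ 0 := (sub_pos.2 hy.2).ne'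
    have hxy : x / (1 - x) = y / (1 - y) := hxy
    rw [div_eq_div_iff h1 h2] at hxy
    linarith
  rw [← himg, integral_image_eq_integral_abs_deriv_smul measurableSet_Ioo hderiv hinj,
    ← setIntegral_Ioo_rpow_mul_one_sub_rpow hs ht]
  refine setIntegral_congr_fun measurableSet_Ioo fun x hx => ?_
  have h1 : 0 < 1 - x := sub_pos.2 hx.2
  have h2 : 1 + x / (1 - x) = (1 - x)⁻¹ := by field_simp; ring
  have h3 : (1 - x) ^ (s + t) = (1 - x) ^ (s - 1) * (1 - x) ^ (t - 1) * (1 - x) ^ 2 := by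
    rw [← Real.rpow_natCast, ← Real.rpow_add h1, ← Real.rpow_add h1]
    congr 1
    push_cast
    ring
  have h4 : 0 < (1 - x) ^ (s - 1) := Real.rpow_pos_of_pos h1 _
  simp only [smul_eq_mul]
  rw [h2, abs_of_pos (by positivity), Real.inv_rpow h1.le, Real.rpow_neg h1.le, inv_inv,
    Real.div_rpow hx.1.le h1.le, h3]
  field_simp

lemma integrableOn_Ioi_one_add_rpow_mul_rpow {s t : ℝ} (hs : 0 < s) (ht : 0 < t) :
    IntegrableOn (fun u : ℝ => (1 + u) ^ (-(s + t)) * u ^ (s - 1)) (Ioi 0) := by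
  refine .of_integral_ne_zero ?_
  rw [setIntegral_Ioi_one_add_rpow_mul_rpow hs ht]
  exact (ProbabilityTheory.beta_pos hs ht).ne'

lemma tendsto_one_add_rpow_sub_one_div_rpow (p : ℝ) {s : ℝ} (hs : s < 1) :
    Tendsto (fun t : ℝ => ((1 + t) ^ p - 1) / t ^ s) (𝓝[>] 0) (𝓝 0) := by
  have hd : HasDerivAt (fun x : ℝ => x ^ p) (p * 1 ^ (p - 1)) 1 :=
    Real.hasDerivAt_rpow_const (.inl one_ne_zero)
  have hpow : Tendsto (fun t : ℝ => t ^ (1 - s)) (𝓝[>] 0) (𝓝 0) := by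
    have h := (Real.continuousAt_rpow_const (0:ℝ) (1 - s) (.inr (by linarith))).tendsto
    rw [Real.zero_rpow (by linarith)] at h
    exact h.mono_left nhdsWithin_le_nhds
  have h := hd.tendsto_slope_zero_right.mul hpow
  rw [mul_zero] at h
  refine h.congr' ?_
  filter_upwards [self_mem_nhdsWithin] with t ht
  have ht : 0 < t := ht
  rw [Real.rpow_sub ht, Real.rpow_one, Real.one_rpow, smul_eq_mul]
  field_simp

lemma tendsto_one_add_rpow_sub_linear_div_rpow (p : ℝ) {s : ℝ} (hs0 : 0 < s) (hs : s < 2) :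
    Tendsto (fun t : ℝ => ((1 + t) ^ p - 1 - p * t) / t ^ s) (𝓝[>] 0) (𝓝 0) := by
  refine HasDerivAt.lhopital_zero_nhdsGT (f' := fun t => p * ((1 + t) ^ (p - 1) - 1))
    (g' := fun t => s * t ^ (s - 1)) ?_ ?_ ?_ ?_ ?_ ?_
  · filter_upwards [self_mem_nhdsWithin] with t ht
    have ht : 0 < t := ht
    have h := (((hasDerivAt_id t).const_add 1).rpow_const (p := p)
      (.inl (by simp only [id]; positivity))).sub_const 1 |>.sub ((hasDerivAt_id t).const_mul p)
    refine h.congr_deriv ?_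
    simp only [id]
    ring
  · filter_upwards [self_mem_nhdsWithin] with t ht
    exact Real.hasDerivAt_rpow_const (.inl (ne_of_gt ht))
  · filter_upwards [self_mem_nhdsWithin] with t ht
    exact (mul_pos hs0 (Real.rpow_pos_of_pos ht _)).ne'
  · have h : ContinuousAt (fun t : ℝ => (1 + t) ^ p - 1 - p * t) 0 := by
      refine ContinuousAt.sub (ContinuousAt.sub ?_ continuousAt_const) (by fun_prop)
      exact ContinuousAt.rpow_const (by fun_prop) (.inl (by norm_num))
    have h := h.tendsto
    simp only [add_zero, Real.one_rpow, sub_self, mul_zero] at h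
    exact h.mono_left nhdsWithin_le_nhds
  · have h := (Real.continuousAt_rpow_const (0:ℝ) s (.inr hs0.le)).tendsto
    rw [Real.zero_rpow hs0.ne'] at h
    exact h.mono_left nhdsWithin_le_nhds
  · have h := (tendsto_one_add_rpow_sub_one_div_rpow (p - 1)
      (show s - 1 < 1 by linarith)).const_mul (p / s)
    rw [mul_zero] at h
    refine h.congr fun t => ?_
    rw [div_mul_div_comm]

lemma one_add_rpow_sub_rpow_le {p u : ℝ} (hp : p ≤ 1) (hu : 0 < u) :
    (1 + u) ^ p - u ^ p ≤ (1 + u) ^ (p - 1) := by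
  have h1 : (1 + u) ^ (p - 1) ≤ u ^ (p - 1) :=
    Real.rpow_le_rpow_of_nonpos hu (by linarith) (by linarith)
  have h2 := Real.rpow_sub_one hu.ne' p
  have h3 := Real.rpow_sub_one (by positivity : 1 + u ≠ 0) p
  rw [eq_div_iff (by positivity)] at h2 h3
  nlinarith

lemma hasDerivAt_one_add_rpow_mul_rpow (p q : ℝ) {u : ℝ} (hu : 0 < u) :
    HasDerivAt (fun u : ℝ => (1 + u) ^ p * u ^ (q + 1))
      ((p + q + 1) * ((1 + u) ^ p * u ^ q) - p * ((1 + u) ^ (p - 1) * u ^ q)) u := by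
  have h := (((hasDerivAt_id u).const_add 1).rpow_const (p := p)
      (.inl (by simp only [id]; positivity))).mul
    (Real.hasDerivAt_rpow_const (p := q + 1) (.inl hu.ne'))
  refine h.congr_deriv ?_
  have h3 := Real.rpow_sub_one (by positivity : 1 + u ≠ 0) p
  rw [eq_div_iff (by positivity)] at h3
  simp only [id, add_sub_cancel_right, Real.rpow_add_one hu.ne', ← h3]
  ring

/-- `∫₀ᵘ ((1+v)^p - v^p) ((1+v)^q - v^q) dv` up to an additive constant and integrals of
`(1+v)^(p-2) v^q` and `(1+v)^(q-2) v^p`. -/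
noncomputable def kernelPrimitive (p q u : ℝ) : ℝ :=
  ((1 + u) ^ (p + q + 1) + u ^ (p + q + 1) - (1 + u) ^ p * u ^ (q + 1)
      - (1 + u) ^ q * u ^ (p + 1)) / (p + q + 1)
    - (p * ((1 + u) ^ (p - 1) * u ^ (q + 1)) + q * ((1 + u) ^ (q - 1) * u ^ (p + 1)))
      / ((p + q) * (p + q + 1))

lemma hasDerivAt_kernelPrimitive {p q u : ℝ} (hp : 0 < p) (hq : 0 < q) (hu : 0 < u) :
    HasDerivAt (kernelPrimitive p q)
      (((1 + u) ^ p - u ^ p) * ((1 + u) ^ q - u ^ q)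
        + (p * (p - 1) / ((p + q) * (p + q + 1)) * ((1 + u) ^ (p - 2) * u ^ q)
          + q * (q - 1) / ((p + q) * (p + q + 1)) * ((1 + u) ^ (q - 2) * u ^ p))) u := by
  have h0 := ((hasDerivAt_id u).const_add 1).rpow_const (p := p + q + 1)
      (.inl (by simp only [id]; positivity))
  have h1 := Real.hasDerivAt_rpow_const (x := u) (p := p + q + 1) (.inl hu.ne')
  have h := ((((h0.add h1).sub (hasDerivAt_one_add_rpow_mul_rpow p q hu)).sub
    (hasDerivAt_one_add_rpow_mul_rpow q p hu)).div_const (p + q + 1)).sub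
    ((((hasDerivAt_one_add_rpow_mul_rpow (p - 1) q hu).const_mul p).add
      ((hasDerivAt_one_add_rpow_mul_rpow (q - 1) p hu).const_mul q)).div_const
        ((p + q) * (p + q + 1)))
  refine h.congr_deriv ?_
  have hu1 : 0 < 1 + u := by positivity
  simp only [id, add_sub_cancel_right, Real.rpow_add hu, Real.rpow_add hu1,
    show p - 1 - 1 = p - 2 by ring, show q - 1 - 1 = q - 2 by ring]
  have : p + q ≠ 0 := by positivity
  have : p + q + 1 ≠ 0 := by positivity
  field_simp
  ring

lemma continuousAt_kernelPrimitive_zero {p q : ℝ} (hp : 0 < p) (hq : 0 < q) :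
    ContinuousAt (kernelPrimitive p q) 0 := by
  have h1 : ∀ r : ℝ, ContinuousAt (fun u : ℝ => (1 + u) ^ r) 0 := fun r =>
    ContinuousAt.rpow_const (by fun_prop) (.inl (by norm_num))
  have h2 : ∀ r : ℝ, 0 < r → ContinuousAt (fun u : ℝ => u ^ r) 0 := fun r hr =>
    Real.continuousAt_rpow_const _ _ (.inr hr.le)
  have h3 := h2 (p + q + 1) (by positivity)
  have h4 := h2 (p + 1) (by positivity)
  have h5 := h2 (q + 1) (by positivity)
  exact (((((h1 _).add h3).sub ((h1 _).mul h5)).sub ((h1 _).mul h4)).div_const _).sub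
    (((((h1 _).mul h5).const_mul _).add (((h1 _).mul h4).const_mul _)).div_const _)

lemma kernelPrimitive_zero {p q : ℝ} (hp : 0 < p) (hq : 0 < q) :
    kernelPrimitive p q 0 = 1 / (p + q + 1) := by
  have h3 : p + q + 1 ≠ 0 := by positivity
  have h4 : p + 1 ≠ 0 := by positivity
  have h5 : q + 1 ≠ 0 := by positivity
  simp [kernelPrimitive, Real.zero_rpow, h3, h4, h5]

lemma tendsto_kernelPrimitive_atTop {p q : ℝ} (hp : 0 < p) (hq : 0 < q) (hpq : p + q < 1) :
    Tendsto (kernelPrimitive p q) atTop (𝓝 0) := by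
  have hs0 : 0 < p + q + 1 := by positivity
  have hs : p + q + 1 < 2 := by linarith
  have hE := fun r => tendsto_one_add_rpow_sub_linear_div_rpow r hs0 hs
  have he := fun r => tendsto_one_add_rpow_sub_one_div_rpow r hpq
  have h := ((((hE (p + q + 1)).sub (hE p)).sub (hE q)).sub
    ((((he (p - 1)).const_mul p).add ((he (q - 1)).const_mul q)).div_const (p + q))).div_const
      (p + q + 1)
  simp only [mul_zero, sub_zero, add_zero, zero_div] at h
  refine (h.comp tendsto_inv_atTop_nhdsGT_zero).congr' ?_
  filter_upwards [eventually_gt_atTop 0] with u hu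
  have hu1 : ∀ r : ℝ, (1 + u⁻¹) ^ r = (1 + u) ^ r / u ^ r := fun r => by
    rw [← Real.div_rpow (by positivity) hu.le]
    congr 1
    field_simp
    ring
  have hu' : 0 < 1 + u := by positivity
  have : p + q ≠ 0 := by positivity
  have : p + q + 1 ≠ 0 := by positivity
  have : 0 < u ^ p := Real.rpow_pos_of_pos hu _
  have : 0 < u ^ q := Real.rpow_pos_of_pos hu _
  simp only [Function.comp, kernelPrimitive, hu1, Real.inv_rpow hu.le, Real.rpow_add hu,
    Real.rpow_add hu', Real.rpow_sub hu, Real.rpow_sub hu', Real.rpow_one]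
  field_simp
  ring

lemma integrableOn_Ioi_kernel_mul {p q : ℝ} (hp : 0 < p) (hq : 0 < q) (hpq : p + q < 1) :
    IntegrableOn (fun u : ℝ => ((1 + u) ^ p - u ^ p) * ((1 + u) ^ q - u ^ q)) (Ioi 0) := by
  have hdom : IntegrableOn (fun u : ℝ => (u + 1) ^ (p + q - 2)) (Ioi 0) :=
    integrableOn_add_rpow_Ioi_of_lt (by linarith) (by norm_num)
  refine Integrable.mono' hdom (by fun_prop) ?_
  refine ae_restrict_of_forall_mem measurableSet_Ioi fun u hu => ?_
  have hu : 0 < u := hu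
  have hnn : ∀ r : ℝ, 0 < r → 0 ≤ (1 + u) ^ r - u ^ r := fun r hr =>
    sub_nonneg.2 (Real.rpow_le_rpow hu.le (by linarith) hr.le)
  rw [Real.norm_of_nonneg (mul_nonneg (hnn p hp) (hnn q hq)), add_comm u,
    show p + q - 2 = (p - 1) + (q - 1) by ring, Real.rpow_add (by positivity)]
  exact mul_le_mul (one_add_rpow_sub_rpow_le (by linarith) hu)
    (one_add_rpow_sub_rpow_le (by linarith) hu) (hnn q hq) (by positivity)

lemma kernel_coeff_mul_beta {p q : ℝ} (hp : 0 < p) (hq : 0 < q) (hpq : p + q < 1) :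
    p * (p - 1) / ((p + q) * (p + q + 1)) *
        (Real.Gamma (q + 1) * Real.Gamma (1 - p - q) / Real.Gamma (q + 1 + (1 - p - q))) =
      Real.Gamma (-p - q - 1) * (Real.Gamma (q + 1) / Real.Gamma (-p)) := by
  have h1 : Real.Gamma (q + 1 + (1 - p - q)) = (1 - p) * (-p * Real.Gamma (-p)) := by
    rw [← Real.Gamma_add_one (by linarith : -p ≠ 0), show -p + 1 = 1 - p by ring,
      ← Real.Gamma_add_one (by linarith : 1 - p ≠ 0)]
    congr 1
    ring
  have h2 : Real.Gamma (1 - p - q) = (-p - q) * ((-p - q - 1) * Real.Gamma (-p - q - 1)) := by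
    rw [← Real.Gamma_add_one (by linarith : -p - q - 1 ≠ 0), sub_add_cancel,
      ← Real.Gamma_add_one (by linarith : -p - q ≠ 0)]
    congr 1
    ring
  have h3 : Real.Gamma (-p) ≠ 0 := by
    intro h
    rw [h] at h1
    exact (Real.Gamma_pos_of_pos (by linarith : 0 < q + 1 + (1 - p - q))).ne' (by simp [h1])
  have : p + q ≠ 0 := by positivity
  have : p + q + 1 ≠ 0 := by positivity
  have : 1 - p ≠ 0 := by linarith
  rw [h1, h2]
  field_simp
  ring

lemma setIntegral_Ioi_kernel_mul {p q : ℝ} (hp : 0 < p) (hq : 0 < q) (hpq : p + q < 1) :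
    ∫ u in Ioi (0:ℝ), ((1 + u) ^ p - u ^ p) * ((1 + u) ^ q - u ^ q) =
      -1 / (p + q + 1) - Real.Gamma (-p - q - 1) *
        (Real.Gamma (p + 1) / Real.Gamma (-q) + Real.Gamma (q + 1) / Real.Gamma (-p)) := by
  have hq1 : 0 < q + 1 := by positivity
  have hp1 : 0 < p + 1 := by positivity
  have hr : 0 < 1 - p - q := by linarith
  have hr' : 0 < 1 - q - p := by linarith
  have i1 := integrableOn_Ioi_one_add_rpow_mul_rpow hq1 hr
  have i2 := integrableOn_Ioi_one_add_rpow_mul_rpow hp1 hr'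
  have v1 := setIntegral_Ioi_one_add_rpow_mul_rpow hq1 hr
  have v2 := setIntegral_Ioi_one_add_rpow_mul_rpow hp1 hr'
  rw [show -(q + 1 + (1 - p - q)) = p - 2 by ring, add_sub_cancel_right] at i1 v1
  rw [show -(p + 1 + (1 - q - p)) = q - 2 by ring, add_sub_cancel_right] at i2 v2
  have i0 := integrableOn_Ioi_kernel_mul hp hq hpq
  have j1 := i1.const_mul (p * (p - 1) / ((p + q) * (p + q + 1)))
  have j2 := i2.const_mul (q * (q - 1) / ((p + q) * (p + q + 1)))
  have key := integral_Ioi_of_hasDerivAt_of_tendsto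
    (continuousAt_kernelPrimitive_zero hp hq).continuousWithinAt
    (fun u hu => hasDerivAt_kernelPrimitive hp hq hu) (i0.add (j1.add j2))
    (tendsto_kernelPrimitive_atTop hp hq hpq)
  erw [integral_add i0 (j1.add j2), integral_add j1 j2] at key
  rw [ integral_const_mul, integral_const_mul,
    v1, v2, kernel_coeff_mul_beta hp hq hpq, kernelPrimitive_zero hp hq] at key
  have c2 := kernel_coeff_mul_beta hq hp (by linarith)
  rw [show (q + p) * (q + p + 1) = (p + q) * (p + q + 1) by ring,
    show -q - p - 1 = -p - q - 1 by ring] at c2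
  rw [c2] at key
  rw [neg_div]
  linarith

/-- Integral identity for the cross term of the Mandelbrot–van Ness kernels:
`∫_0^∞ ((1+u)^{a-1/2} - u^{a-1/2})((1+u)^{b-1/2} - u^{b-1/2}) du
  = -1/(a+b) - Γ(-a-b)(Γ(1/2+a)/Γ(1/2-b) + Γ(1/2+b)/Γ(1/2-a))`. -/
theorem stmt11 (a b : ℝ) (ha : a ∈ Set.Ioo (1/2 : ℝ) 1) (hb : b ∈ Set.Ioo (1/2 : ℝ) 1) :
    IntegrableOn (fun u : ℝ =>
        ((1 + u) ^ (a - 1/2) - u ^ (a - 1/2)) * ((1 + u) ^ (b - 1/2) - u ^ (b - 1/2)))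
      (Set.Ioi 0) ∧
    ∫ u in Set.Ioi (0:ℝ),
        ((1 + u) ^ (a - 1/2) - u ^ (a - 1/2)) * ((1 + u) ^ (b - 1/2) - u ^ (b - 1/2)) =
      -1 / (a + b) - Real.Gamma (-a - b) *
        (Real.Gamma (1/2 + a) / Real.Gamma (1/2 - b) +
         Real.Gamma (1/2 + b) / Real.Gamma (1/2 - a)) := by
  have ha' : 0 < a - 1/2 := by linarith [ha.1]
  have hb' : 0 < b - 1/2 := by linarith [hb.1]
  have hab : (a - 1/2) + (b - 1/2) < 1 := by linarith [ha.2, hb.2]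
  refine ⟨integrableOn_Ioi_kernel_mul ha' hb' hab, ?_⟩
  rw [setIntegral_Ioi_kernel_mul ha' hb' hab]
  ring_nf
end

section
/- For all a, b ∈ (1/2, 1) and every v > 0, the function r ↦ ((v-r)^{a-1/2} - max(-r,0)^{a-1/2})((v-r)^{b-1/2} - max(-r,0)^{b-1/2}) is Lebesgue integrable on (-∞, v), and ∫_{-∞}^{v} ((v-r)^{a-1/2} - max(-r,0)^{a-1/2})((v-r)^{b-1/2} - max(-r,0)^{b-1/2}) dr = -v^{a+b} Γ(-a-b)( Γ(1/2+a)/Γ(1/2-b) + Γ(1/2+b)/Γ(1/2-a) ). -/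
open MeasureTheory

/-- The truncated power `x₊ ^ e`, valued in `ℝ≥0∞` and vanishing on `(-∞, 0]`. -/
noncomputable def truncPow (e x : ℝ) : ENNReal :=
  (Set.Ioi (0 : ℝ)).indicator (fun y => ENNReal.ofReal (y ^ e)) x

theorem truncPow_of_pos {e x : ℝ} (hx : 0 < x) : truncPow e x = ENNReal.ofReal (x ^ e) :=
  Set.indicator_of_mem (Set.mem_Ioi.2 hx) _

theorem truncPow_of_nonpos {e x : ℝ} (hx : x ≤ 0) : truncPow e x = 0 :=
  Set.indicator_of_notMem (by simpa using hx) _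

@[fun_prop]
theorem measurable_truncPow (e : ℝ) : Measurable (truncPow e) :=
  Measurable.indicator (by fun_prop) measurableSet_Ioi

theorem lintegral_rpow_mul_exp_neg_mul_Ioi {p x : ℝ} (hp : 0 < p) (hx : 0 < x) :
    ∫⁻ t in Set.Ioi (0 : ℝ), ENNReal.ofReal (t ^ (p - 1) * Real.exp (-(x * t))) =
      ENNReal.ofReal ((1 / x) ^ p * Real.Gamma p) := by
  have h := Real.integral_rpow_mul_exp_neg_mul_Ioi hp hx
  have hpos : 0 < (1 / x) ^ p * Real.Gamma p :=
    mul_pos (Real.rpow_pos_of_pos (by positivity) _) (Real.Gamma_pos_of_pos hp)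
  rw [← h, ofReal_integral_eq_lintegral_ofReal]
  · exact Integrable.of_integral_ne_zero (by rw [h]; exact hpos.ne')
  · filter_upwards [ae_restrict_mem measurableSet_Ioi] with t ht
    exact mul_nonneg (Real.rpow_nonneg (le_of_lt ht) _) (Real.exp_pos _).le

/-- The beta integral over the half-line. -/
theorem lintegral_truncPow_mul_truncPow_add {α β c : ℝ} (hα : 0 < α) (hβ : β < 1)
    (hs : α + β < 1) (hc : 0 < c) :
    ∫⁻ y, truncPow (α - 1) y * truncPow (β - 1) (y + c) =
      ENNReal.ofReal (Real.Gamma α * Real.Gamma (1 - (α + β)) / Real.Gamma (1 - β)) *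
        truncPow (α + β - 1) c := by
  have hG : 0 < Real.Gamma (1 - β) := Real.Gamma_pos_of_pos (by linarith)
  have hA : 0 < Real.Gamma α := Real.Gamma_pos_of_pos hα
  have hS : 0 < Real.Gamma (1 - (α + β)) := Real.Gamma_pos_of_pos (by linarith)
  have h0 : ∫⁻ y, truncPow (α - 1) y * truncPow (β - 1) (y + c) =
      ∫⁻ y in Set.Ioi (0 : ℝ), truncPow (α - 1) y * truncPow (β - 1) (y + c) := by
    rw [← lintegral_indicator measurableSet_Ioi]
    congr 1 with y
    by_cases hy : 0 < y
    · rw [Set.indicator_of_mem (Set.mem_Ioi.2 hy)]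
    · rw [Set.indicator_of_notMem (by simpa using hy), truncPow_of_nonpos (not_lt.1 hy), zero_mul]
  have key : ENNReal.ofReal (Real.Gamma (1 - β)) *
      ∫⁻ y in Set.Ioi (0 : ℝ), truncPow (α - 1) y * truncPow (β - 1) (y + c) =
      ENNReal.ofReal (Real.Gamma α * Real.Gamma (1 - (α + β)) * c ^ (α + β - 1)) := by
    calc
      _ = ∫⁻ y in Set.Ioi (0 : ℝ), ∫⁻ t in Set.Ioi (0 : ℝ),
          ENNReal.ofReal (y ^ (α - 1)) *
            ENNReal.ofReal (t ^ ((1 - β) - 1) * Real.exp (-((y + c) * t))) := by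
        rw [← lintegral_const_mul _ (by fun_prop)]
        refine setLIntegral_congr_fun measurableSet_Ioi fun y hy => ?_
        have hy : 0 < y := hy
        rw [lintegral_const_mul _ (by fun_prop),
          lintegral_rpow_mul_exp_neg_mul_Ioi (by linarith) (by linarith),
          truncPow_of_pos hy, truncPow_of_pos (by linarith),
          one_div, Real.inv_rpow (by linarith), ← Real.rpow_neg (by linarith), neg_sub,
          ENNReal.ofReal_mul (Real.rpow_nonneg (by linarith) _)]
        ring
      _ = ∫⁻ t in Set.Ioi (0 : ℝ), ∫⁻ y in Set.Ioi (0 : ℝ),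
          ENNReal.ofReal (y ^ (α - 1)) *
            ENNReal.ofReal (t ^ ((1 - β) - 1) * Real.exp (-((y + c) * t))) :=
        lintegral_lintegral_swap (by unfold Function.uncurry; fun_prop)
      _ = ∫⁻ t in Set.Ioi (0 : ℝ), ENNReal.ofReal (Real.Gamma α) *
            ENNReal.ofReal (t ^ ((1 - (α + β)) - 1) * Real.exp (-(c * t))) := by
        refine setLIntegral_congr_fun measurableSet_Ioi fun t ht => ?_
        have ht : 0 < t := ht
        have h1 : ∀ y ∈ Set.Ioi (0 : ℝ), ENNReal.ofReal (y ^ (α - 1)) *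
            ENNReal.ofReal (t ^ ((1 - β) - 1) * Real.exp (-((y + c) * t))) =
            ENNReal.ofReal (t ^ ((1 - β) - 1) * Real.exp (-(c * t))) *
            ENNReal.ofReal (y ^ (α - 1) * Real.exp (-(t * y))) := by
          intro y hy
          have hy : 0 < y := hy
          rw [← ENNReal.ofReal_mul (by positivity), ← ENNReal.ofReal_mul (by positivity),
            show -((y + c) * t) = -(c * t) + -(t * y) by ring, Real.exp_add]
          congr 1
          ring
        rw [setLIntegral_congr_fun measurableSet_Ioi h1, lintegral_const_mul _ (by fun_prop),
          lintegral_rpow_mul_exp_neg_mul_Ioi hα ht, ← ENNReal.ofReal_mul (by positivity),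
          ← ENNReal.ofReal_mul (by positivity), one_div, Real.inv_rpow ht.le,
          ← Real.rpow_neg ht.le, show (1 - (α + β)) - 1 = ((1 - β) - 1) + -α by ring,
          Real.rpow_add ht]
        congr 1
        ring
      _ = _ := by
        rw [lintegral_const_mul _ (by fun_prop),
          lintegral_rpow_mul_exp_neg_mul_Ioi (by linarith) hc, one_div, Real.inv_rpow hc.le,
          ← Real.rpow_neg hc.le, neg_sub, ← ENNReal.ofReal_mul (by positivity)]
        congr 1
        ring
  rw [h0, truncPow_of_pos hc, ← ENNReal.ofReal_mul (by positivity)]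
  have hne : ENNReal.ofReal (Real.Gamma (1 - β)) ≠ 0 := by simpa using hG
  rw [← ENNReal.mul_right_inj hne ENNReal.ofReal_ne_top, key, ← ENNReal.ofReal_mul hG.le]
  congr 1
  field_simp

theorem setLIntegral_truncPow_sub {e r v : ℝ} (he : -1 < e) (hv : 0 < v) (hr : r < v) :
    ∫⁻ u in Set.Ioc 0 v, truncPow e (u - r) =
      ENNReal.ofReal (((v - r) ^ (e + 1) - max (-r) 0 ^ (e + 1)) / (e + 1)) := by
  have hm : max r 0 ≤ v := max_le hr.le hv.le
  have hm' : max r 0 - r = max (-r) 0 := by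
    rcases le_total r 0 with h | h
    · rw [max_eq_right h, max_eq_left (by linarith)]; ring
    · rw [max_eq_left h, max_eq_right (by linarith)]; ring
  have h1 : ∫⁻ u in Set.Ioc 0 v, truncPow e (u - r) =
      ∫⁻ u in Set.Ioc (max r 0) v, ENNReal.ofReal ((u - r) ^ e) := by
    rw [← lintegral_indicator measurableSet_Ioc, ← lintegral_indicator measurableSet_Ioc]
    congr 1 with u
    by_cases hu : r < u
    · simp only [Set.indicator_apply, Set.mem_Ioc, max_lt_iff, hu, true_and]
      rw [truncPow_of_pos (by linarith)]
    · simp only [Set.indicator_apply, Set.mem_Ioc, max_lt_iff, hu, false_and, if_false]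
      rw [truncPow_of_nonpos (by linarith), ite_self]
  have hint : IntervalIntegrable (fun u => (u - r) ^ e) volume (max r 0) v :=
    by simpa using (intervalIntegral.intervalIntegrable_rpow' (a := max r 0 - r) (b := v - r)
      he).comp_sub_right r
  rw [h1, ← ofReal_integral_eq_lintegral_ofReal
    ((intervalIntegrable_iff_integrableOn_Ioc_of_le hm).1 hint),
    ← intervalIntegral.integral_of_le hm,
    intervalIntegral.integral_comp_sub_right (fun x => x ^ e), integral_rpow (Or.inl he), hm']
  filter_upwards [ae_restrict_mem measurableSet_Ioc] with u hu
  exact Real.rpow_nonneg (by linarith [hu.1, le_max_left r 0]) _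

theorem lintegral_truncPow_sub_mul_truncPow_sub {α β u w : ℝ} (hα : 0 < α) (hβ : 0 < β)
    (hs : α + β < 1) (huw : u ≠ w) :
    ∫⁻ r, truncPow (α - 1) (u - r) * truncPow (β - 1) (w - r) =
      ENNReal.ofReal (Real.Gamma α * Real.Gamma (1 - (α + β)) / Real.Gamma (1 - β)) *
        truncPow (α + β - 1) (w - u) +
      ENNReal.ofReal (Real.Gamma β * Real.Gamma (1 - (α + β)) / Real.Gamma (1 - α)) *
        truncPow (α + β - 1) (u - w) := by
  rcases huw.lt_or_gt with h | h
  · rw [truncPow_of_nonpos (x := u - w) (by linarith), mul_zero, add_zero,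
      ← lintegral_truncPow_mul_truncPow_add hα (by linarith) hs (by linarith),
      ← lintegral_sub_left_eq_self _ u]
    refine lintegral_congr fun x => ?_
    rw [sub_sub_cancel, show w - (u - x) = x + (w - u) by ring]
  · rw [truncPow_of_nonpos (x := w - u) (by linarith), mul_zero, zero_add, add_comm α β,
      ← lintegral_truncPow_mul_truncPow_add hβ (by linarith) (by linarith) (by linarith),
      ← lintegral_sub_left_eq_self _ w]
    refine lintegral_congr fun x => ?_
    rw [sub_sub_cancel, show u - (w - x) = x + (u - w) by ring, mul_comm]

theorem lintegral_lintegral_truncPow_sub {e v : ℝ} (he : -1 < e) (hv : 0 < v) :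
    ∫⁻ u in Set.Ioc 0 v, ∫⁻ w in Set.Ioc 0 v, truncPow e (w - u) =
      ENNReal.ofReal (v ^ (e + 2) / ((e + 1) * (e + 2))) := by
  have h1 : ∀ᵐ u ∂(volume.restrict (Set.Ioc 0 v)),
      ∫⁻ w in Set.Ioc 0 v, truncPow e (w - u) =
        ENNReal.ofReal ((e + 1)⁻¹ ) * truncPow (e + 1) (v - u) := by
    filter_upwards [ae_restrict_mem measurableSet_Ioc,
      ae_restrict_of_ae (Measure.ae_ne volume v)] with u hu huv
    have huv : u < v := lt_of_le_of_ne hu.2 huv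
    rw [setLIntegral_truncPow_sub he hv huv, max_eq_right (by linarith [hu.1]),
      Real.zero_rpow (by linarith), truncPow_of_pos (by linarith),
      ← ENNReal.ofReal_mul (inv_nonneg.2 (by linarith))]
    congr 1
    ring
  have h2 : ∫⁻ u in Set.Ioc 0 v, truncPow (e + 1) (v - u) =
      ∫⁻ u in Set.Ioc 0 v, truncPow (e + 1) (u - 0) := by
    rw [← lintegral_indicator measurableSet_Ioc, ← lintegral_indicator measurableSet_Ioc,
      ← lintegral_sub_left_eq_self _ v]
    refine lintegral_congr_ae ?_
    filter_upwards [Measure.ae_ne volume v, Measure.ae_ne volume 0] with u h1 h2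
    have : v - u ∈ Set.Ioc 0 v ↔ u ∈ Set.Ioc 0 v := by
      simp only [Set.mem_Ioc]
      constructor
      · rintro ⟨h3, h4⟩
        exact ⟨lt_of_le_of_ne (by linarith) (Ne.symm h2), by linarith⟩
      · rintro ⟨h3, h4⟩
        exact ⟨sub_pos.2 (lt_of_le_of_ne h4 h1), by linarith⟩
    simp only [Set.indicator_apply, this, sub_zero, sub_sub_cancel]
  rw [lintegral_congr_ae h1, lintegral_const_mul _ (by fun_prop), h2,
    setLIntegral_truncPow_sub (by linarith) hv hv, ← ENNReal.ofReal_mul (inv_nonneg.2 (by linarith))]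
  simp only [sub_zero, neg_zero, max_self]
  rw [Real.zero_rpow (by linarith), show e + 1 + 1 = e + 2 by ring]
  congr 1
  have : e + 1 ≠ 0 := by linarith
  have : e + 2 ≠ 0 := by linarith
  field_simp
  ring

theorem lintegral_kernel_mul_kernel {α β v : ℝ} (hα : 0 < α) (hβ : 0 < β)
    (hs : α + β < 1) (hv : 0 < v) :
    ∫⁻ r in Set.Iio v, ENNReal.ofReal
        (((v - r) ^ α - max (-r) 0 ^ α) * ((v - r) ^ β - max (-r) 0 ^ β)) =
      ENNReal.ofReal (α * β * (v ^ (α + β + 1) / ((α + β) * (α + β + 1))) *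
        Real.Gamma (1 - (α + β)) *
        (Real.Gamma α / Real.Gamma (1 - β) + Real.Gamma β / Real.Gamma (1 - α))) := by
  have hker : ∀ {γ r : ℝ}, 0 < γ → r < v → ENNReal.ofReal ((v - r) ^ γ - max (-r) 0 ^ γ) =
      ENNReal.ofReal γ * ∫⁻ u in Set.Ioc 0 v, truncPow (γ - 1) (u - r) := by
    intro γ r hγ hr
    rw [setLIntegral_truncPow_sub (by linarith) hv hr, ← ENNReal.ofReal_mul hγ.le]
    congr 1
    rw [sub_add_cancel]
    field_simp
  have hnn : ∀ {γ r : ℝ}, 0 < γ → r < v → 0 ≤ (v - r) ^ γ - max (-r) 0 ^ γ := by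
    intro γ r hγ hr
    exact sub_nonneg.2 (Real.rpow_le_rpow (le_max_right _ _)
      (max_le (by linarith) (by linarith)) hγ.le)
  have hvan : ∀ {γ r : ℝ}, v ≤ r → ∫⁻ u in Set.Ioc 0 v, truncPow (γ - 1) (u - r) = 0 := by
    intro γ r hr
    rw [setLIntegral_congr_fun measurableSet_Ioc (g := fun _ => 0)
      fun u hu => truncPow_of_nonpos (by linarith [hu.2]), lintegral_zero]
  have hGa : 0 < Real.Gamma α := Real.Gamma_pos_of_pos hα
  have hGb : 0 < Real.Gamma β := Real.Gamma_pos_of_pos hβ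
  have hGa' : 0 < Real.Gamma (1 - α) := Real.Gamma_pos_of_pos (by linarith)
  have hGb' : 0 < Real.Gamma (1 - β) := Real.Gamma_pos_of_pos (by linarith)
  have hS : 0 < Real.Gamma (1 - (α + β)) := Real.Gamma_pos_of_pos (by linarith)
  set C₁ := Real.Gamma α * Real.Gamma (1 - (α + β)) / Real.Gamma (1 - β) with hC₁
  set C₂ := Real.Gamma β * Real.Gamma (1 - (α + β)) / Real.Gamma (1 - α) with hC₂
  have hC₁p : 0 < C₁ := by positivity
  have hC₂p : 0 < C₂ := by positivity
  calc
    _ = ∫⁻ r, ENNReal.ofReal (α * β) * ∫⁻ u in Set.Ioc 0 v, ∫⁻ w in Set.Ioc 0 v,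
          truncPow (α - 1) (u - r) * truncPow (β - 1) (w - r) := by
      rw [← lintegral_indicator measurableSet_Iio]
      congr 1 with r
      simp_rw [lintegral_const_mul (truncPow (α - 1) (_ - r))
        (show Measurable fun w => truncPow (β - 1) (w - r) by fun_prop)]
      rw [lintegral_mul_const _ (by fun_prop)]
      by_cases hr : r < v
      · rw [Set.indicator_of_mem (Set.mem_Iio.2 hr), ENNReal.ofReal_mul (hnn hα hr),
          hker hα hr, hker hβ hr, ENNReal.ofReal_mul hα.le]
        ring
      · rw [Set.indicator_of_notMem (by simpa using hr), hvan (not_lt.1 hr), zero_mul, mul_zero]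
    _ = ENNReal.ofReal (α * β) * ∫⁻ u in Set.Ioc 0 v, ∫⁻ w in Set.Ioc 0 v, ∫⁻ r,
          truncPow (α - 1) (u - r) * truncPow (β - 1) (w - r) := by
      rw [lintegral_const_mul' _ _ ENNReal.ofReal_ne_top, lintegral_lintegral_swap]
      · congr 2 with u
        rw [lintegral_lintegral_swap]
        unfold Function.uncurry
        fun_prop
      · refine Measurable.aemeasurable ?_
        unfold Function.uncurry
        refine Measurable.lintegral_prod_right'
          (f := fun q : (ℝ × ℝ) × ℝ =>
            truncPow (α - 1) (q.1.2 - q.1.1) * truncPow (β - 1) (q.2 - q.1.1)) ?_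
        fun_prop
    _ = ENNReal.ofReal (α * β) * ∫⁻ u in Set.Ioc 0 v, ∫⁻ w in Set.Ioc 0 v,
          (ENNReal.ofReal C₁ * truncPow (α + β - 1) (w - u) +
            ENNReal.ofReal C₂ * truncPow (α + β - 1) (u - w)) := by
      congr 2 with u
      refine lintegral_congr_ae ?_
      filter_upwards [ae_restrict_of_ae (Measure.ae_ne volume u)] with w hw
      exact lintegral_truncPow_sub_mul_truncPow_sub hα hβ hs hw.symm
    _ = ENNReal.ofReal (α * β) *
          (ENNReal.ofReal C₁ *
            (∫⁻ u in Set.Ioc 0 v, ∫⁻ w in Set.Ioc 0 v, truncPow (α + β - 1) (w - u)) +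
          ENNReal.ofReal C₂ *
            ∫⁻ u in Set.Ioc 0 v, ∫⁻ w in Set.Ioc 0 v, truncPow (α + β - 1) (u - w)) := by
      congr 1
      rw [← lintegral_const_mul' _ _ ENNReal.ofReal_ne_top,
        ← lintegral_const_mul' _ _ ENNReal.ofReal_ne_top, ← lintegral_add_left]
      · congr 1 with u
        rw [lintegral_add_left (by fun_prop), lintegral_const_mul _ (by fun_prop),
          lintegral_const_mul _ (by fun_prop)]
      · refine Measurable.const_mul (Measurable.lintegral_prod_right'
          (f := fun q : ℝ × ℝ => truncPow (α + β - 1) (q.2 - q.1)) ?_) _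
        fun_prop
    _ = _ := by
      rw [lintegral_lintegral_swap (f := fun u w => truncPow (α + β - 1) (u - w))
          (by unfold Function.uncurry; fun_prop),
        lintegral_lintegral_truncPow_sub (by linarith) hv,
        show α + β - 1 + 1 = α + β by ring, show α + β - 1 + 2 = α + β + 1 by ring,
        ← ENNReal.ofReal_mul hC₁p.le, ← ENNReal.ofReal_mul hC₂p.le,
        ← ENNReal.ofReal_add (by positivity) (by positivity),
        ← ENNReal.ofReal_mul (by positivity)]
      congr 1
      rw [hC₁, hC₂]
      ring

/-- Product of two Mandelbrot–van Ness kernels: for `a, b ∈ (1/2,1)` and `v > 0`,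
`∫_{-∞}^v ((v-r)^{a-1/2} - (-r)_+^{a-1/2})((v-r)^{b-1/2} - (-r)_+^{b-1/2}) dr
  = -v^{a+b} Γ(-a-b)(Γ(1/2+a)/Γ(1/2-b) + Γ(1/2+b)/Γ(1/2-a))`. -/
theorem stmt12 (a b v : ℝ) (ha : a ∈ Set.Ioo (1/2 : ℝ) 1) (hb : b ∈ Set.Ioo (1/2 : ℝ) 1)
    (hv : 0 < v) :
    IntegrableOn (fun r : ℝ =>
        ((v - r) ^ (a - 1/2) - max (-r) 0 ^ (a - 1/2)) *
        ((v - r) ^ (b - 1/2) - max (-r) 0 ^ (b - 1/2)))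
      (Set.Iio v) ∧
    ∫ r in Set.Iio v,
        ((v - r) ^ (a - 1/2) - max (-r) 0 ^ (a - 1/2)) *
        ((v - r) ^ (b - 1/2) - max (-r) 0 ^ (b - 1/2)) =
      -(v ^ (a + b)) * Real.Gamma (-a - b) *
        (Real.Gamma (1/2 + a) / Real.Gamma (1/2 - b) +
         Real.Gamma (1/2 + b) / Real.Gamma (1/2 - a)) := by
  obtain ⟨ha1, ha2⟩ := ha
  obtain ⟨hb1, hb2⟩ := hb
  obtain ⟨α, rfl⟩ : ∃ α, a = α + 1 / 2 := ⟨a - 1 / 2, by ring⟩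
  obtain ⟨β, rfl⟩ : ∃ β, b = β + 1 / 2 := ⟨b - 1 / 2, by ring⟩
  have hα : 0 < α := by linarith
  have hβ : 0 < β := by linarith
  have hs : α + β < 1 := by linarith
  simp only [add_sub_cancel_right]
  have hL := lintegral_kernel_mul_kernel hα hβ hs hv
  have hnn : ∀ᵐ r ∂(volume.restrict (Set.Iio v)),
      0 ≤ ((v - r) ^ α - max (-r) 0 ^ α) * ((v - r) ^ β - max (-r) 0 ^ β) := by
    filter_upwards [ae_restrict_mem measurableSet_Iio] with r hr
    have hr : r < v := hr
    have hm : max (-r) 0 ≤ v - r := max_le (by linarith) (by linarith)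
    exact mul_nonneg
      (sub_nonneg.2 (Real.rpow_le_rpow (le_max_right _ _) hm hα.le))
      (sub_nonneg.2 (Real.rpow_le_rpow (le_max_right _ _) hm hβ.le))
  have hmeas : Measurable fun r : ℝ =>
      ((v - r) ^ α - max (-r) 0 ^ α) * ((v - r) ^ β - max (-r) 0 ^ β) := by fun_prop
  constructor
  · refine (lintegral_ofReal_ne_top_iff_integrable hmeas.aestronglyMeasurable hnn).1 ?_
    rw [hL]
    exact ENNReal.ofReal_ne_top
  · have hGa : 0 < Real.Gamma α := Real.Gamma_pos_of_pos hα
    have hGb : 0 < Real.Gamma β := Real.Gamma_pos_of_pos hβ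
    have hGa' : 0 < Real.Gamma (1 - α) := Real.Gamma_pos_of_pos (by linarith)
    have hGb' : 0 < Real.Gamma (1 - β) := Real.Gamma_pos_of_pos (by linarith)
    have hS : 0 < Real.Gamma (1 - (α + β)) := Real.Gamma_pos_of_pos (by linarith)
    rw [integral_eq_lintegral_of_nonneg_ae hnn hmeas.aestronglyMeasurable, hL,
      ENNReal.toReal_ofReal (by positivity)]
    have e1 : Real.Gamma (1 - (α + β)) =
        (α + β) * (α + β + 1) * Real.Gamma (-(α + 1 / 2) - (β + 1 / 2)) := by
      have h1 := Real.Gamma_add_one (s := -(α + β)) (by linarith)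
      have h2 := Real.Gamma_add_one (s := -(α + β) - 1) (by linarith)
      rw [show -(α + 1 / 2) - (β + 1 / 2) = -(α + β) - 1 by ring,
        show 1 - (α + β) = -(α + β) + 1 by ring, h1]
      rw [sub_add_cancel] at h2
      rw [h2]
      ring
    have e2 : ∀ {γ : ℝ}, 0 < γ → Real.Gamma (1 / 2 + (γ + 1 / 2)) = γ * Real.Gamma γ := by
      intro γ hγ
      rw [← Real.Gamma_add_one hγ.ne']
      congr 1
      ring
    have e3 : ∀ {γ : ℝ}, 0 < γ →
        Real.Gamma (1 / 2 - (γ + 1 / 2)) = -(Real.Gamma (1 - γ) / γ) := by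
      intro γ hγ
      rw [show 1 / 2 - (γ + 1 / 2) = -γ by ring, show 1 - γ = -γ + 1 by ring,
        Real.Gamma_add_one (by linarith)]
      field_simp
    rw [e1, e2 hα, e2 hβ, e3 hα, e3 hβ,
      show α + 1 / 2 + (β + 1 / 2) = α + β + 1 by ring]
    field_simp
    ring
end

section
/- For H ∈ (1/2,1) set C_H := (-2 Γ(-2H) Γ(1/2+H)/Γ(1/2-H))^{-1/2}, and for H₁, H₂ ∈ (1/2,1) set f(H₁,H₂) := -Γ(-H₁-H₂) C_{H₁} C_{H₂} ( Γ(1/2+H₁)/Γ(1/2-H₂) + Γ(1/2+H₂)/Γ(1/2-H₁) ). Then for all H₁, H₂ ∈ (1/2,1) one has 0 < f(H₁,H₂) ≤ 1, and f(H,H) = 1 for every H ∈ (1/2,1). -/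
/-- The fBm normalization constant `C_H = (-2Γ(-2H)Γ(1/2+H)/Γ(1/2-H))^{-1/2}`. -/
noncomputable def CH (H : ℝ) : ℝ :=
  (-2 * Real.Gamma (-2 * H) * Real.Gamma (1/2 + H) / Real.Gamma (1/2 - H)) ^ (-(1/2) : ℝ)

/-- The normalized cross-covariance factor
`f(H₁,H₂) = -Γ(-H₁-H₂) C_{H₁} C_{H₂} (Γ(1/2+H₁)/Γ(1/2-H₂) + Γ(1/2+H₂)/Γ(1/2-H₁))`. -/
noncomputable def fcov (H₁ H₂ : ℝ) : ℝ :=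
  -Real.Gamma (-H₁ - H₂) * CH H₁ * CH H₂ *
    (Real.Gamma (1/2 + H₁) / Real.Gamma (1/2 - H₂) +
     Real.Gamma (1/2 + H₂) / Real.Gamma (1/2 - H₁))

open Filter Topology

/-- Over the half-line, the midpoint ratio `Γ(x + δ) Γ(x - δ) / Γ(x)²` decreases in `x`. -/
theorem Gamma_add_mul_Gamma_sub_le {A B δ : ℝ} (hB : |δ| < B) (hAB : B ≤ A) :
    Real.Gamma (A + δ) * Real.Gamma (A - δ) * Real.Gamma B ^ 2 ≤
      Real.Gamma (B + δ) * Real.Gamma (B - δ) * Real.Gamma A ^ 2 := by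
  obtain ⟨h1, h2⟩ := abs_lt.mp hB
  have key : ∀ᶠ n : ℕ in atTop,
      Real.GammaSeq (A + δ) n * Real.GammaSeq (A - δ) n * Real.GammaSeq B n ^ 2 ≤
        Real.GammaSeq (B + δ) n * Real.GammaSeq (B - δ) n * Real.GammaSeq A n ^ 2 := by
    filter_upwards [eventually_gt_atTop 0] with n hn
    have hn' : (0 : ℝ) < n := by exact_mod_cast hn
    have hpos : ∀ x : ℝ, 0 < x → 0 < ∏ j ∈ Finset.range (n + 1), (x + j) := fun x hx =>
      Finset.prod_pos fun j _ => by positivity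
    have hprod : (∏ j ∈ Finset.range (n + 1), (B + δ + j)) *
          (∏ j ∈ Finset.range (n + 1), (B - δ + j)) *
          (∏ j ∈ Finset.range (n + 1), (A + j)) ^ 2 ≤
        (∏ j ∈ Finset.range (n + 1), (A + δ + j)) *
          (∏ j ∈ Finset.range (n + 1), (A - δ + j)) *
          (∏ j ∈ Finset.range (n + 1), (B + j)) ^ 2 := by
      simp only [← Finset.prod_pow, ← Finset.prod_mul_distrib]
      refine Finset.prod_le_prod (fun j _ => ?_) fun j _ => ?_
      · have h3 : 0 < B + δ + j := by have := j.cast_nonneg (α := ℝ); linarith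
        have h4 : 0 < B - δ + j := by have := j.cast_nonneg (α := ℝ); linarith
        positivity
      · have hsq : (B + j) ^ 2 ≤ (A + j) ^ 2 := by
          have := j.cast_nonneg (α := ℝ)
          gcongr
          linarith
        nlinarith [mul_le_mul_of_nonneg_left hsq (sq_nonneg δ)]
    have hpow : (n : ℝ) ^ (A + δ) * (n : ℝ) ^ (A - δ) * ((n : ℝ) ^ B) ^ 2 =
        (n : ℝ) ^ (B + δ) * (n : ℝ) ^ (B - δ) * ((n : ℝ) ^ A) ^ 2 := by
      simp only [sq, ← Real.rpow_add hn']
      congr 1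
      ring
    have e1 := hpos (A + δ) (by linarith)
    have e2 := hpos (A - δ) (by linarith)
    have e3 := hpos B (by linarith)
    have e4 := hpos (B + δ) (by linarith)
    have e5 := hpos (B - δ) (by linarith)
    have e6 := hpos A (by linarith)
    simp only [Real.GammaSeq, div_pow, div_mul_div_comm]
    rw [show ∀ a b c d : ℝ, a * d * (b * d) * (c * d) ^ 2 = a * b * c ^ 2 * d ^ 4 by
      intros; ring, hpow, show ∀ a b c d : ℝ, a * d * (b * d) * (c * d) ^ 2 =
        a * b * c ^ 2 * d ^ 4 by intros; ring]
    exact div_le_div_of_nonneg_left (by positivity) (by positivity) hprod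
  exact le_of_tendsto_of_tendsto
    (((Real.GammaSeq_tendsto_Gamma _).mul (Real.GammaSeq_tendsto_Gamma _)).mul
      ((Real.GammaSeq_tendsto_Gamma _).pow 2))
    (((Real.GammaSeq_tendsto_Gamma _).mul (Real.GammaSeq_tendsto_Gamma _)).mul
      ((Real.GammaSeq_tendsto_Gamma _).pow 2)) key

theorem cos_pi_mul_neg {H : ℝ} (hH : H ∈ Set.Ioo (1/2 : ℝ) 1) : Real.cos (Real.pi * H) < 0 :=
  Real.cos_neg_of_pi_div_two_lt_of_lt (by nlinarith [Real.pi_pos, hH.1])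
    (by nlinarith [Real.pi_pos, hH.2])

theorem inv_Gamma_half_sub {H : ℝ} (hH : H ∈ Set.Ioo (1/2 : ℝ) 1) :
    (Real.Gamma (1/2 - H))⁻¹ = Real.Gamma (1/2 + H) * Real.cos (Real.pi * H) / Real.pi := by
  have hr := Real.Gamma_mul_Gamma_one_sub (1/2 + H)
  rw [show 1 - (1/2 + H) = 1/2 - H by ring,
    show Real.pi * (1/2 + H) = Real.pi * H + Real.pi / 2 by ring, Real.sin_add_pi_div_two] at hr
  have hc := (cos_pi_mul_neg hH).ne
  have hpi := Real.pi_ne_zero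
  have hne : Real.Gamma (1/2 - H) ≠ 0 := by
    intro h
    rw [h, mul_zero] at hr
    exact div_ne_zero hpi hc hr.symm
  rw [eq_div_iff hc] at hr
  rw [eq_div_iff hpi, inv_mul_eq_iff_eq_mul₀ hne]
  linear_combination -hr

/-- The spectral integral `-2 Γ(-2H) cos(πH) / π`. -/
noncomputable def spectralFactor (H : ℝ) : ℝ :=
  -2 * Real.Gamma (-2 * H) * Real.cos (Real.pi * H) / Real.pi

theorem spectralFactor_eq {H : ℝ} (hH : H ∈ Set.Ioo (1/2 : ℝ) 1) :
    spectralFactor H =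
      2 ^ (-2 * H) / √Real.pi * (Real.Gamma (1 - H) / (H * Real.Gamma (1/2 + H))) := by
  have hH0 : H ≠ 0 := by linarith [hH.1]
  have hg : Real.Gamma (1/2 + H) ≠ 0 := (Real.Gamma_pos_of_pos (by linarith [hH.1])).ne'
  have hd := Real.Gamma_mul_Gamma_add_half (-H)
  have hi := inv_Gamma_half_sub hH
  have hs := Real.Gamma_add_one (neg_ne_zero.mpr hH0)
  have hne : Real.Gamma (1/2 - H) ≠ 0 := by
    intro h
    rw [h, inv_zero] at hi
    exact div_ne_zero (mul_ne_zero hg (cos_pi_mul_neg hH).ne) Real.pi_ne_zero hi.symm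
  rw [show -H + 1/2 = 1/2 - H by ring, show 2 * -H = -2 * H by ring,
    show 1 - -2 * H = 1 + 2 * H by ring, Real.rpow_add two_pos, Real.rpow_one] at hd
  rw [show -H + 1 = 1 - H by ring] at hs
  have hc : Real.cos (Real.pi * H) / Real.pi =
      (Real.Gamma (1/2 - H))⁻¹ / Real.Gamma (1/2 + H) := by
    rw [hi, mul_div_assoc, mul_div_cancel_left₀ _ hg]
  have hp : (0 : ℝ) < 2 ^ (2 * H) := by positivity
  have hsp : 0 < √Real.pi := Real.sqrt_pos.mpr Real.pi_pos
  rw [spectralFactor, mul_div_assoc, hc, hs, neg_mul 2 H, Real.rpow_neg two_pos.le]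
  rw [neg_mul 2 H] at hd
  generalize Real.Gamma (1/2 + H) = g at *
  generalize Real.Gamma (1/2 - H) = k at *
  field_simp
  linear_combination hd

theorem spectralFactor_pos {H : ℝ} (hH : H ∈ Set.Ioo (1/2 : ℝ) 1) : 0 < spectralFactor H := by
  rw [spectralFactor_eq hH]
  have h0 : 0 < H := by linarith [hH.1]
  have h1 := Real.Gamma_pos_of_pos (show 0 < 1 - H by linarith [hH.2])
  have h2 := Real.Gamma_pos_of_pos (show 0 < 1/2 + H by linarith)
  have := Real.pi_pos
  positivity

theorem Gamma_neg_two_mul_pos {H : ℝ} (hH : H ∈ Set.Ioo (1/2 : ℝ) 1) :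
    0 < Real.Gamma (-2 * H) := by
  have h := spectralFactor_pos hH
  rw [spectralFactor, div_pos_iff_of_pos_right Real.pi_pos] at h
  nlinarith [cos_pi_mul_neg hH]

theorem spectralFactor_midpoint_sq_le {x y : ℝ} (hx : x ∈ Set.Ioo (1/2 : ℝ) 1)
    (hy : y ∈ Set.Ioo (1/2 : ℝ) 1) :
    spectralFactor ((x + y) / 2) ^ 2 ≤ spectralFactor x * spectralFactor y := by
  obtain ⟨hx1, hx2⟩ := hx
  obtain ⟨hy1, hy2⟩ := hy
  have hs : (x + y) / 2 ∈ Set.Ioo (1/2 : ℝ) 1 := ⟨by linarith, by linarith⟩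
  rw [spectralFactor_eq hs, spectralFactor_eq ⟨hx1, hx2⟩, spectralFactor_eq ⟨hy1, hy2⟩]
  have key := Gamma_add_mul_Gamma_sub_le (A := 1/2 + (x + y) / 2) (B := 1 - (x + y) / 2)
    (δ := (x - y) / 2) (abs_lt.mpr ⟨by linarith, by linarith⟩) (by linarith)
  rw [show 1/2 + (x + y) / 2 + (x - y) / 2 = 1/2 + x by ring,
    show 1/2 + (x + y) / 2 - (x - y) / 2 = 1/2 + y by ring,
    show 1 - (x + y) / 2 + (x - y) / 2 = 1 - y by ring,
    show 1 - (x + y) / 2 - (x - y) / 2 = 1 - x by ring] at key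
  have hpow : (2 : ℝ) ^ (-2 * x) * 2 ^ (-2 * y) = (2 ^ (-2 * ((x + y) / 2))) ^ 2 := by
    rw [sq, ← Real.rpow_add two_pos, ← Real.rpow_add two_pos]
    congr 1
    ring
  have g1 := Real.Gamma_pos_of_pos (show 0 < 1/2 + x by linarith)
  have g2 := Real.Gamma_pos_of_pos (show 0 < 1/2 + y by linarith)
  have g3 := Real.Gamma_pos_of_pos (show 0 < 1/2 + (x + y) / 2 by linarith)
  have g4 := Real.Gamma_pos_of_pos (show 0 < 1 - x by linarith)
  have g5 := Real.Gamma_pos_of_pos (show 0 < 1 - y by linarith)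
  have hx0 : 0 < x := by linarith
  have hy0 : 0 < y := by linarith
  have hratio : (Real.Gamma (1 - (x + y) / 2) /
        ((x + y) / 2 * Real.Gamma (1/2 + (x + y) / 2))) ^ 2 ≤
      Real.Gamma (1 - x) / (x * Real.Gamma (1/2 + x)) *
        (Real.Gamma (1 - y) / (y * Real.Gamma (1/2 + y))) := by
    rw [div_pow, div_mul_div_comm, div_le_div_iff₀ (by positivity) (by positivity)]
    have hm : x * y ≤ ((x + y) / 2) ^ 2 := by nlinarith [sq_nonneg (x - y)]
    have := mul_le_mul hm key (by positivity) (by positivity)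
    linarith
  calc _ = (2 ^ (-2 * ((x + y) / 2))) ^ 2 / √Real.pi ^ 2 * (Real.Gamma (1 - (x + y) / 2) /
        ((x + y) / 2 * Real.Gamma (1/2 + (x + y) / 2))) ^ 2 := by ring
    _ ≤ (2 ^ (-2 * ((x + y) / 2))) ^ 2 / √Real.pi ^ 2 *
        (Real.Gamma (1 - x) / (x * Real.Gamma (1/2 + x)) *
        (Real.Gamma (1 - y) / (y * Real.Gamma (1/2 + y)))) := by gcongr
    _ = _ := by rw [← hpow]; ring

theorem CH_base_eq {H : ℝ} (hH : H ∈ Set.Ioo (1/2 : ℝ) 1) :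
    -2 * Real.Gamma (-2 * H) * Real.Gamma (1/2 + H) / Real.Gamma (1/2 - H) =
      spectralFactor H * Real.Gamma (1/2 + H) ^ 2 := by
  rw [div_eq_mul_inv, inv_Gamma_half_sub hH, spectralFactor]
  ring

theorem CH_pos {H : ℝ} (hH : H ∈ Set.Ioo (1/2 : ℝ) 1) : 0 < CH H := by
  have h1 := spectralFactor_pos hH
  have h2 := Real.Gamma_pos_of_pos (show 0 < 1/2 + H by linarith [hH.1])
  rw [CH, CH_base_eq hH]
  positivity

theorem CH_sq_mul {H : ℝ} (hH : H ∈ Set.Ioo (1/2 : ℝ) 1) :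
    CH H ^ 2 * (spectralFactor H * Real.Gamma (1/2 + H) ^ 2) = 1 := by
  have h1 := spectralFactor_pos hH
  have h2 := Real.Gamma_pos_of_pos (show 0 < 1/2 + H by linarith [hH.1])
  have h3 : 0 < spectralFactor H * Real.Gamma (1/2 + H) ^ 2 := by positivity
  rw [CH, CH_base_eq hH, ← Real.rpow_natCast, ← Real.rpow_mul h3.le]
  norm_num
  rw [Real.rpow_neg_one]
  exact inv_mul_cancel₀ h3.ne'

theorem fcov_eq {x y : ℝ} (hx : x ∈ Set.Ioo (1/2 : ℝ) 1) (hy : y ∈ Set.Ioo (1/2 : ℝ) 1) :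
    fcov x y = CH x * CH y * Real.Gamma (1/2 + x) * Real.Gamma (1/2 + y) *
      (Real.Gamma (-2 * ((x + y) / 2)) *
        (-(Real.cos (Real.pi * x) + Real.cos (Real.pi * y))) / Real.pi) := by
  rw [fcov, div_eq_mul_inv (Real.Gamma (1/2 + x)), div_eq_mul_inv (Real.Gamma (1/2 + y)),
    inv_Gamma_half_sub hx, inv_Gamma_half_sub hy,
    show -x - y = -2 * ((x + y) / 2) by ring]
  ring

/-- For all `H₁, H₂ ∈ (1/2,1)`, `0 < f(H₁,H₂) ≤ 1`, and `f(H,H) = 1`. -/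
theorem stmt14 :
    (∀ H₁ ∈ Set.Ioo (1/2 : ℝ) 1, ∀ H₂ ∈ Set.Ioo (1/2 : ℝ) 1,
      0 < fcov H₁ H₂ ∧ fcov H₁ H₂ ≤ 1) ∧
    (∀ H ∈ Set.Ioo (1/2 : ℝ) 1, fcov H H = 1) := by
  refine ⟨fun x hx y hy => ?_, fun H hH => ?_⟩
  · have hs : (x + y) / 2 ∈ Set.Ioo (1/2 : ℝ) 1 :=
      ⟨by linarith [hx.1, hy.1], by linarith [hx.2, hy.2]⟩
    have g1 := Real.Gamma_pos_of_pos (show 0 < 1/2 + x by linarith [hx.1])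
    have g2 := Real.Gamma_pos_of_pos (show 0 < 1/2 + y by linarith [hy.1])
    have c1 := CH_pos hx
    have c2 := CH_pos hy
    have hG := Gamma_neg_two_mul_pos hs
    have hpi := Real.pi_pos
    have hcos : 0 < -(Real.cos (Real.pi * x) + Real.cos (Real.pi * y)) := by
      linarith [cos_pi_mul_neg hx, cos_pi_mul_neg hy]
    rw [fcov_eq hx hy]
    refine ⟨by positivity, ?_⟩
    have hle : -(Real.cos (Real.pi * x) + Real.cos (Real.pi * y)) ≤
        -2 * Real.cos (Real.pi * ((x + y) / 2)) := by
      rw [Real.cos_add_cos, show (Real.pi * x + Real.pi * y) / 2 = Real.pi * ((x + y) / 2) by ring]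
      nlinarith [cos_pi_mul_neg hs, Real.cos_le_one ((Real.pi * x - Real.pi * y) / 2)]
    have hfac : Real.Gamma (-2 * ((x + y) / 2)) *
        (-(Real.cos (Real.pi * x) + Real.cos (Real.pi * y))) / Real.pi ≤
          spectralFactor ((x + y) / 2) := by
      calc _ ≤ Real.Gamma (-2 * ((x + y) / 2)) *
            (-2 * Real.cos (Real.pi * ((x + y) / 2))) / Real.pi := by gcongr
        _ = _ := by rw [spectralFactor]; ring
    refine (mul_le_mul_of_nonneg_left hfac (by positivity)).trans ?_
    refine (abs_le_of_sq_le_sq' ?_ zero_le_one).2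
    calc _ = (CH x * CH y * Real.Gamma (1/2 + x) * Real.Gamma (1/2 + y)) ^ 2 *
          spectralFactor ((x + y) / 2) ^ 2 := by ring
      _ ≤ (CH x * CH y * Real.Gamma (1/2 + x) * Real.Gamma (1/2 + y)) ^ 2 *
          (spectralFactor x * spectralFactor y) :=
        mul_le_mul_of_nonneg_left (spectralFactor_midpoint_sq_le hx hy) (by positivity)
      _ = (CH x ^ 2 * (spectralFactor x * Real.Gamma (1/2 + x) ^ 2)) *
          (CH y ^ 2 * (spectralFactor y * Real.Gamma (1/2 + y) ^ 2)) := by ring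
      _ = 1 ^ 2 := by rw [CH_sq_mul hx, CH_sq_mul hy]; norm_num
  · have h := CH_sq_mul hH
    rw [spectralFactor] at h
    rw [fcov_eq hH hH, add_self_div_two]
    linear_combination h
end

section
/- For H ∈ (1/2,1) set C_H := (-2 Γ(-2H) Γ(1/2+H)/Γ(1/2-H))^{-1/2}, and for H₁, H₂ ∈ (1/2,1) set f(H₁,H₂) := -Γ(-H₁-H₂) C_{H₁} C_{H₂} ( Γ(1/2+H₁)/Γ(1/2-H₂) + Γ(1/2+H₂)/Γ(1/2-H₁) ). Then for every compact interval [H̲, H̄] ⊂ (1/2,1) there exists a constant C such that for all H₁, H₂ ∈ [H̲, H̄], |1 - f(H₁,H₂)| ≤ C |H₁ - H₂|. -/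
theorem Complex.isOpen_setOf_forall_ne_neg_natCast : IsOpen {s : ℂ | ∀ m : ℕ, s ≠ -m} := by
  have h : IsClosed (Set.range fun m : ℕ => (-m : ℂ)) := by
    convert Complex.isClosedEmbedding_intCast.isClosedMap _
      (isClosed_discrete (Set.range fun m : ℕ => (-m : ℤ))) using 1
    rw [← Set.range_comp]
    congr 1
    ext m
    simp
  convert h.isOpen_compl using 1
  ext s
  simp [eq_comm]

theorem Complex.contDiffAt_Gamma {s : ℂ} (hs : ∀ m : ℕ, s ≠ -m) {n : WithTop ℕ∞} :
    ContDiffAt ℂ n Complex.Gamma s := by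
  have h : DifferentiableOn ℂ Complex.Gamma {s : ℂ | ∀ m : ℕ, s ≠ -m} := fun z hz =>
    (Complex.differentiableAt_Gamma z hz).differentiableWithinAt
  exact (h.analyticAt (Complex.isOpen_setOf_forall_ne_neg_natCast.mem_nhds hs)).contDiffAt

theorem Real.contDiffAt_Gamma {s : ℝ} (hs : ∀ m : ℕ, s ≠ -m) {n : WithTop ℕ∞} :
    ContDiffAt ℝ n Real.Gamma s := by
  have h : ContDiffAt ℂ n Complex.Gamma (s : ℂ) :=
    Complex.contDiffAt_Gamma fun m hm => hs m (by exact_mod_cast hm)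
  exact h.real_of_complex

theorem ne_neg_natCast_of_mem_Ioo {s : ℝ} (k : ℕ) (h1 : -(k : ℝ) - 1 < s) (h2 : s < -k) (m : ℕ) :
    s ≠ -m := by
  rintro rfl
  have h3 : m < k + 1 := by
    have : (m : ℝ) < ((k + 1 : ℕ) : ℝ) := by push_cast; linarith
    exact_mod_cast this
  have h4 : k < m := by
    have : (k : ℝ) < m := by linarith
    exact_mod_cast this
  omega

theorem Real.Gamma_neg_of_mem_Ioo {s : ℝ} (h1 : -1 < s) (h2 : s < 0) : Real.Gamma s < 0 := by
  have h := Real.Gamma_add_one h2.ne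
  have hp : 0 < Real.Gamma (s + 1) := Real.Gamma_pos_of_pos (by linarith)
  nlinarith

theorem Real.Gamma_pos_of_mem_Ioo {s : ℝ} (h1 : -2 < s) (h2 : s < -1) : 0 < Real.Gamma s := by
  have h := Real.Gamma_add_one (s := s) (by linarith)
  have hp : Real.Gamma (s + 1) < 0 := Real.Gamma_neg_of_mem_Ioo (by linarith) (by linarith)
  nlinarith

theorem CH_base_pos {H : ℝ} (h1 : 1/2 < H) (h2 : H < 1) :
    0 < -2 * Real.Gamma (-2 * H) * Real.Gamma (1/2 + H) / Real.Gamma (1/2 - H) := by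
  have a : 0 < Real.Gamma (-2 * H) := Real.Gamma_pos_of_mem_Ioo (by linarith) (by linarith)
  have b : 0 < Real.Gamma (1/2 + H) := Real.Gamma_pos_of_pos (by linarith)
  have c : Real.Gamma (1/2 - H) < 0 := Real.Gamma_neg_of_mem_Ioo (by linarith) (by linarith)
  apply div_pos_of_neg_of_neg _ c
  have := mul_pos a b
  nlinarith

theorem fcov_self {H : ℝ} (h1 : 1/2 < H) (h2 : H < 1) : fcov H H = 1 := by
  have hA := CH_base_pos h1 h2
  have hC : CH H * CH H =
      (-2 * Real.Gamma (-2 * H) * Real.Gamma (1/2 + H) / Real.Gamma (1/2 - H))⁻¹ := by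
    unfold CH
    rw [← Real.rpow_add hA, ← Real.rpow_neg_one]
    norm_num
  calc fcov H H = (-2 * Real.Gamma (-2 * H) * Real.Gamma (1/2 + H) / Real.Gamma (1/2 - H)) *
        (CH H * CH H) := by
        unfold fcov
        rw [show -H - H = -2 * H by ring]
        ring
    _ = 1 := by rw [hC, mul_inv_cancel₀ hA.ne']

theorem contDiffAt_Gamma_half_add {H : ℝ} (h1 : 1/2 < H) {n : WithTop ℕ∞} :
    ContDiffAt ℝ n (fun x : ℝ => Real.Gamma (1/2 + x)) H := by
  refine (Real.contDiffAt_Gamma fun m => ?_).comp H (f := fun x : ℝ => 1/2 + x) (by fun_prop)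
  have : (0 : ℝ) ≤ m := m.cast_nonneg
  linarith

theorem contDiffAt_Gamma_half_sub {H : ℝ} (h1 : 1/2 < H) (h2 : H < 1) {n : WithTop ℕ∞} :
    ContDiffAt ℝ n (fun x : ℝ => Real.Gamma (1/2 - x)) H :=
  (Real.contDiffAt_Gamma (ne_neg_natCast_of_mem_Ioo 0 (by norm_num; linarith)
    (by norm_num; linarith))).comp H (f := fun x : ℝ => 1/2 - x) (by fun_prop)

theorem Gamma_half_sub_ne_zero {H : ℝ} (h1 : 1/2 < H) (h2 : H < 1) :
    Real.Gamma (1/2 - H) ≠ 0 :=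
  (Real.Gamma_neg_of_mem_Ioo (by linarith) (by linarith)).ne

theorem contDiffAt_CH {H : ℝ} (h1 : 1/2 < H) (h2 : H < 1) {n : WithTop ℕ∞} :
    ContDiffAt ℝ n CH H := by
  have a : ContDiffAt ℝ n (fun x : ℝ => Real.Gamma (-2 * x)) H :=
    (Real.contDiffAt_Gamma (ne_neg_natCast_of_mem_Ioo 1 (by norm_num; linarith)
      (by norm_num; linarith))).comp H (f := fun x : ℝ => -2 * x) (by fun_prop)
  exact (((contDiffAt_const.mul a).mul (contDiffAt_Gamma_half_add h1)).div
    (contDiffAt_Gamma_half_sub h1 h2) (Gamma_half_sub_ne_zero h1 h2)).rpow_const_of_ne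
      (CH_base_pos h1 h2).ne'

theorem contDiffAt_fcov {p : ℝ × ℝ} (h1 : 1/2 < p.1) (h2 : p.1 < 1) (h3 : 1/2 < p.2)
    (h4 : p.2 < 1) {n : WithTop ℕ∞} : ContDiffAt ℝ n (fun q : ℝ × ℝ => fcov q.1 q.2) p := by
  have a : ContDiffAt ℝ n (fun q : ℝ × ℝ => Real.Gamma (-q.1 - q.2)) p :=
    (Real.contDiffAt_Gamma (ne_neg_natCast_of_mem_Ioo 1 (by norm_num; linarith)
      (by norm_num; linarith))).comp p (f := fun q : ℝ × ℝ => -q.1 - q.2) (by fun_prop)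
  have b : ContDiffAt ℝ n
      (fun q : ℝ × ℝ => Real.Gamma (1/2 + q.1) / Real.Gamma (1/2 - q.2)) p :=
    ((contDiffAt_Gamma_half_add h1).comp p contDiffAt_fst).div
      ((contDiffAt_Gamma_half_sub h3 h4).comp p contDiffAt_snd) (Gamma_half_sub_ne_zero h3 h4)
  have c : ContDiffAt ℝ n
      (fun q : ℝ × ℝ => Real.Gamma (1/2 + q.2) / Real.Gamma (1/2 - q.1)) p :=
    ((contDiffAt_Gamma_half_add h3).comp p contDiffAt_snd).div
      ((contDiffAt_Gamma_half_sub h1 h2).comp p contDiffAt_fst) (Gamma_half_sub_ne_zero h1 h2)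
  exact ((a.neg.mul ((contDiffAt_CH h1 h2).comp p contDiffAt_fst)).mul
    ((contDiffAt_CH h3 h4).comp p contDiffAt_snd)).mul (b.add c)

/-- Lipschitz estimate near the diagonal: on every compact interval `[H̲, H̄] ⊂ (1/2,1)`
there is `C` with `|1 - f(H₁,H₂)| ≤ C |H₁ - H₂|`. -/
theorem stmt15 (Hlow Hhigh : ℝ) (h₁ : 1/2 < Hlow) (h₂ : Hhigh < 1) (h₃ : Hlow ≤ Hhigh) :
    ∃ C > 0, ∀ H₁ ∈ Set.Icc Hlow Hhigh, ∀ H₂ ∈ Set.Icc Hlow Hhigh,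
      |1 - fcov H₁ H₂| ≤ C * |H₁ - H₂| := by
  have hd : ContDiffOn ℝ 1 (fun q : ℝ × ℝ => fcov q.1 q.2)
      (Set.Icc Hlow Hhigh ×ˢ Set.Icc Hlow Hhigh) := fun p hp =>
    (contDiffAt_fcov (h₁.trans_le hp.1.1) (hp.1.2.trans_lt h₂) (h₁.trans_le hp.2.1)
      (hp.2.2.trans_lt h₂)).contDiffWithinAt
  obtain ⟨K, hK⟩ := hd.exists_lipschitzOnWith one_ne_zero
    ((convex_Icc _ _).prod (convex_Icc _ _)) (isCompact_Icc.prod isCompact_Icc)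
  refine ⟨K + 1, by positivity, fun x hx y hy => ?_⟩
  have h := hK.dist_le_mul (x, x) ⟨hx, hx⟩ (x, y) ⟨hx, hy⟩
  simp only [Prod.dist_eq, dist_self, Real.dist_eq,
    fcov_self (h₁.trans_le hx.1) (hx.2.trans_lt h₂), max_eq_right (abs_nonneg (x - y))] at h
  linarith [abs_nonneg (x - y)]
end
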